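/- arXiv:1105.1052 — 4 statements merged into one kernel-verified Lean document; each statement's English description precedes it below -/
import Mathlib

section
/- Let c > 0, L > 0, M an even integer, Δ := L/M with 0 < Δ < 4/c, and ν := −2i/Δ + ic/2. Let (λ_1,…,λ_N) ∈ ℝ^N and (μ_1,…,μ_{N+1}) ∈ ℝ^{N+1} be solutions of the lattice Bethe equations in the N- and (N+1)-particle sectors respectively, with pairwise distinct entries within each set, μ_a ≠ λ_b for all a, b, and Ŝ(λ_j) ≠ 1 for all j = 1,…,N. Set λ_{N+1} := ν. Then det_{N+1}[Ω_{jk}] = Y(ν | λ_1,…,λ_{N+1}) · ∏_{k=1}^{N} [ a(λ_k)·∏_{a=1}^{N+1} (μ_a − λ_k − ic) · (1 − Ŝ(λ_k)) ] · det_{N+1}[1/(μ_j − λ_k)] · det_{N}[δ_{jk} + U^{(Δ)}_{jk}], where for j, k = 1,…,N+1: Ω_{jk} := a(λ_k)·t(μ_j, λ_k)·∏_{a=1}^{N+1}(μ_a − λ_k − ic) − d(λ_k)·t(λ_k, μ_j)·∏_{a=1}^{N+1}(μ_a − λ_k + ic) with t(λ, μ) := −ic/((λ − μ)(λ − μ −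 ic)); Y(λ | τ_1,…,τ_{N+1}) := a(λ)·∏_{k=1}^{N+1}(τ_k − λ − ic) + d(λ)·∏_{k=1}^{N+1}(τ_k − λ + ic); and for j, k = 1,…,N: U^{(Δ)}_{jk} := −i · ∏_{a=1}^{N+1} (λ_j − μ_a)/(λ_j − μ_a + ic) · [∏_{a=1}^{N}(λ_j − λ_a + ic)] / [∏_{a=1, a≠j}^{N}(λ_j − λ_a)] · K(λ_j, λ_k | ν)/(Ŝ(λ_j) − 1), with K(ω, ω′ | ν) := (ν − ω − ic)/(ν − ω) · { K(ω − ω′) − i·(1 − (ν − ω′ + ic)/(ν − ω′ − ic))·(1/(ω − ω′ + ic) − 1/(ω − ν + ic)) } and K(λ) := 2c/(λ² + c²). -/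
open scoped BigOperators

/-- The lattice eigenvalue function
a(λ) = (−iλΔ/2 + 1 + cΔ/4)^{M/2}·(−iλΔ/2 + 1 − cΔ/4)^{M/2}. -/
noncomputable def aLat (c Δ : ℝ) (M : ℕ) (l : ℂ) : ℂ :=
  (-Complex.I * l * (Δ : ℂ) / 2 + 1 + (c : ℂ) * (Δ : ℂ) / 4) ^ (M / 2) *
    (-Complex.I * l * (Δ : ℂ) / 2 + 1 - (c : ℂ) * (Δ : ℂ) / 4) ^ (M / 2)

/-- The lattice eigenvalue function
d(λ) = (iλΔ/2 + 1 + cΔ/4)^{M/2}·(iλΔ/2 + 1 − cΔ/4)^{M/2}. -/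
noncomputable def dLat (c Δ : ℝ) (M : ℕ) (l : ℂ) : ℂ :=
  (Complex.I * l * (Δ : ℂ) / 2 + 1 + (c : ℂ) * (Δ : ℂ) / 4) ^ (M / 2) *
    (Complex.I * l * (Δ : ℂ) / 2 + 1 - (c : ℂ) * (Δ : ℂ) / 4) ^ (M / 2)

/-- t(λ,μ) = −ic/((λ−μ)(λ−μ−ic)). -/
noncomputable def tFn (c : ℝ) (l m : ℂ) : ℂ :=
  -Complex.I * (c : ℂ) / ((l - m) * (l - m - Complex.I * (c : ℂ)))

/-- The exponentiated discreet shift function Ŝ(ω). -/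
noncomputable def shiftS (c : ℝ) (N : ℕ) (mu : Fin (N + 1) → ℂ) (lam : Fin N → ℂ)
    (ω : ℂ) : ℂ :=
  (∏ a : Fin (N + 1),
      (mu a - ω + Complex.I * (c : ℂ)) / (mu a - ω - Complex.I * (c : ℂ))) *
    ∏ a : Fin N,
      (lam a - ω - Complex.I * (c : ℂ)) / (lam a - ω + Complex.I * (c : ℂ))

/-- The deformed kernel K(ω,ω′|ν) = (ν−ω−ic)/(ν−ω)·{ K(ω−ω′) −
i·(1 − (ν−ω′+ic)/(ν−ω′−ic))·(1/(ω−ω′+ic) − 1/(ω−ν+ic)) }, with K(λ) = 2c/(λ²+c²). -/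
noncomputable def kMod (c : ℝ) (ν ω ω' : ℂ) : ℂ :=
  (ν - ω - Complex.I * (c : ℂ)) / (ν - ω) *
    (2 * (c : ℂ) / ((ω - ω') ^ 2 + (c : ℂ) ^ 2)
      - Complex.I * (1 - (ν - ω' + Complex.I * (c : ℂ)) / (ν - ω' - Complex.I * (c : ℂ))) *
          (1 / (ω - ω' + Complex.I * (c : ℂ)) - 1 / (ω - ν + Complex.I * (c : ℂ))))


noncomputable def hF {N : ℕ} (mu : Fin (N + 1) → ℂ) (lam : Fin N → ℂ) (z : ℂ) : ℂ :=
  (∏ a, (z - mu a)) / ∏ p, (z - lam p)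

noncomputable def rF {N : ℕ} (mu : Fin (N + 1) → ℂ) (lam : Fin N → ℂ) (l : Fin N) : ℂ :=
  (∏ a, (lam l - mu a)) / ∏ p ∈ Finset.univ.erase l, (lam l - lam p)

lemma hF_expand {N : ℕ} (mu : Fin (N + 1) → ℂ) (lam : Fin N → ℂ)
    (hl : Function.Injective lam) :
    ∃ C : ℂ, ∀ z : ℂ, (∀ p, z ≠ lam p) →
      hF mu lam z = z + C + ∑ l, rF mu lam l / (z - lam l) := by
  classical
  set P : Polynomial ℂ := Lagrange.nodal Finset.univ mu with hP
  set Q : Polynomial ℂ := Lagrange.nodal Finset.univ lam with hQ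
  have hPm : P.Monic := Lagrange.nodal_monic
  have hQm : Q.Monic := Lagrange.nodal_monic
  have hPd : P.natDegree = N + 1 := by simp [hP, Lagrange.natDegree_nodal]
  have hQd : Q.natDegree = N := by simp [hQ, Lagrange.natDegree_nodal]
  have hle : Q.degree ≤ P.degree := by
    simp [hP, hQ, Lagrange.degree_nodal]
    exact_mod_cast Nat.le_succ N
  have h1 : (P /ₘ Q).natDegree = 1 := by
    rw [Polynomial.natDegree_divByMonic _ hQm, hPd, hQd]; simp
  have h2 : (P /ₘ Q).Monic := by
    rw [Polynomial.Monic, Polynomial.leadingCoeff_divByMonic_of_monic hQm hle]; exact hPm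
  have h3 := h2.eq_X_add_C h1
  have h4 := Polynomial.modByMonic_add_div P Q
  have h5 : (P %ₘ Q).degree < (Finset.univ : Finset (Fin N)).card := by
    have := Polynomial.degree_modByMonic_lt P hQm
    rwa [hQ, Lagrange.degree_nodal] at this
  have h6 := Lagrange.eq_interpolate (s := Finset.univ) (v := lam) hl.injOn h5
  have hPe : ∀ z, P.eval z = ∏ a, (z - mu a) := fun z => Lagrange.eval_nodal
  have hQe : ∀ z, Q.eval z = ∏ a, (z - lam a) := fun z => Lagrange.eval_nodal
  refine ⟨(P /ₘ Q).coeff 0, fun z hz => ?_⟩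
  have hQz : ∏ a, (z - lam a) ≠ 0 :=
    Finset.prod_ne_zero_iff.2 fun p _ => sub_ne_zero.2 (hz p)
  have h7 := congrArg (Polynomial.eval z) h4
  have h8 := congrArg (Polynomial.eval z) h6
  rw [Lagrange.eval_interpolate_not_at_node _ (fun i _ => hz i), Lagrange.eval_nodal] at h8
  rw [Polynomial.eval_add, Polynomial.eval_mul, h8, hPe, hQe, h3] at h7
  have h9 : ∀ l, (P %ₘ Q).eval (lam l) = ∏ a, (lam l - mu a) := by
    intro l
    have := congrArg (Polynomial.eval (lam l)) h4
    rw [Polynomial.eval_add, Polynomial.eval_mul, hPe] at this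
    rw [← this, hQ, Lagrange.eval_nodal_at_node (Finset.mem_univ l)]; simp
  rw [hF, div_eq_iff hQz, ← h7]
  have h10 : ∀ l, Lagrange.nodalWeight Finset.univ lam l * (z - lam l)⁻¹ *
      (P %ₘ Q).eval (lam l) = rF mu lam l / (z - lam l) := by
    intro l
    rw [h9, rF, Lagrange.nodalWeight, Finset.prod_inv_distrib]
    ring
  simp only [h10, Polynomial.eval_add, Polynomial.eval_X, Polynomial.eval_C]
  ring

lemma pf2 {N : ℕ} (mu : Fin (N + 1) → ℂ) (lam : Fin N → ℂ)
    (hl : Function.Injective lam) (x y : ℂ) (hxy : x ≠ y)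
    (hx : ∀ p, x ≠ lam p) (hy : ∀ p, y ≠ lam p) :
    ∑ l, rF mu lam l / ((lam l - x) * (lam l - y))
      = 1 - (hF mu lam x - hF mu lam y) / (x - y) := by
  obtain ⟨C, hC⟩ := hF_expand mu lam hl
  rw [hC x hx, hC y hy]
  have hxy' := sub_ne_zero.2 hxy
  have : ∑ l, rF mu lam l / (x - lam l) - ∑ l, rF mu lam l / (y - lam l)
      = -(x - y) * ∑ l, rF mu lam l / ((lam l - x) * (lam l - y)) := by
    rw [← Finset.sum_sub_distrib, Finset.mul_sum]
    refine Finset.sum_congr rfl fun l _ => ?_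
    have h1 := sub_ne_zero.2 (hx l)
    have h2 := sub_ne_zero.2 (hy l)
    rw [show lam l - x = -(x - lam l) by ring, show lam l - y = -(y - lam l) by ring]
    field_simp
    ring
  rw [eq_sub_iff_add_eq, ← eq_sub_iff_add_eq', div_eq_iff hxy']
  linear_combination this

lemma pf1 {N : ℕ} (mu : Fin (N + 1) → ℂ) (lam : Fin N → ℂ)
    (hl : Function.Injective lam) (hml : ∀ a p, mu a ≠ lam p) (ν z : ℂ)
    (hν : ∀ p, ν ≠ lam p) (hνm : ∀ a, ν ≠ mu a)
    (hz : ∀ p, z ≠ lam p) (hzm : ∀ a, z ≠ mu a) (j : Fin (N + 1)) :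
    1 / (mu j - z) = ∑ l, 1 / (mu j - lam l) *
        (rF mu lam l / (lam l - ν) * (z - ν) / (z - lam l) / hF mu lam z)
      + 1 / (mu j - ν) * (hF mu lam ν / hF mu lam z) := by
  have hz0 : hF mu lam z ≠ 0 := div_ne_zero
    (Finset.prod_ne_zero_iff.2 fun p _ => sub_ne_zero.2 (hzm p))
    (Finset.prod_ne_zero_iff.2 fun p _ => sub_ne_zero.2 (hz p))
  have hm0 : hF mu lam (mu j) = 0 := by
    rw [hF, Finset.prod_eq_zero (Finset.mem_univ j) (sub_self _), zero_div]
  have e1 := pf2 mu lam hl z (mu j) (hzm j) hz (hml j)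
  have e2 := pf2 mu lam hl ν (mu j) (hνm j) hν (hml j)
  rw [hm0, sub_zero] at e1 e2
  have a1 := sub_ne_zero.2 (hzm j)
  have a2 := sub_ne_zero.2 (hνm j)
  have e3 : ∑ l, 1 / (mu j - lam l) *
        (rF mu lam l / (lam l - ν) * (z - ν) / (z - lam l) / hF mu lam z)
      = (∑ l, rF mu lam l / ((lam l - z) * (lam l - mu j))
        - ∑ l, rF mu lam l / ((lam l - ν) * (lam l - mu j))) / hF mu lam z := by
    rw [← Finset.sum_sub_distrib, Finset.sum_div]
    refine Finset.sum_congr rfl fun l _ => ?_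
    have h1 := sub_ne_zero.2 (hz l)
    have h2 := sub_ne_zero.2 (hν l).symm
    have h3 := sub_ne_zero.2 (hml j l)
    rw [show lam l - z = -(z - lam l) by ring, show lam l - mu j = -(mu j - lam l) by ring]
    field_simp
    ring
  rw [e3, e1, e2, show mu j - z = -(z - mu j) by ring, show mu j - ν = -(ν - mu j) by ring]
  field_simp
  ring

noncomputable def sF {N : ℕ} (mu : Fin (N + 1) → ℂ) (lam : Fin N → ℂ) (e : ℂ) (k : Fin N) : ℂ :=
  hF mu lam (lam k - e) / hF mu lam (lam k + e)

noncomputable def kapF {N : ℕ} (lam : Fin N → ℂ) (e : ℂ) (l k : Fin N) : ℂ :=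
  2 * e / ((lam l - (lam k + e)) * (lam l - (lam k - e)))

noncomputable def aM {N : ℕ} (mu : Fin (N + 1) → ℂ) (lam : Fin N → ℂ) (e : ℂ) :
    Matrix (Fin N) (Fin N) ℂ :=
  1 + Matrix.of fun l k => rF mu lam l / (hF mu lam (lam l + e) * (1 - sF mu lam e l)) *
    kapF lam e l k

noncomputable def blockM {N : ℕ} (mu : Fin (N + 1) → ℂ) (lam : Fin N → ℂ) (e : ℂ) :
    Matrix (Fin N) (Fin N) ℂ :=
  Matrix.diagonal (fun k => 1 - sF mu lam e k) + Matrix.of fun l k => rF mu lam l *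
    kapF lam e l k / hF mu lam (lam k + e)

lemma hF_ne {N : ℕ} (mu : Fin (N + 1) → ℂ) (lam : Fin N → ℂ) (z : ℂ)
    (hz : ∀ p, z ≠ lam p) (hzm : ∀ a, z ≠ mu a) : hF mu lam z ≠ 0 := div_ne_zero
    (Finset.prod_ne_zero_iff.2 fun p _ => sub_ne_zero.2 (hzm p))
    (Finset.prod_ne_zero_iff.2 fun p _ => sub_ne_zero.2 (hz p))

lemma det_blockM {N : ℕ} (mu : Fin (N + 1) → ℂ) (lam : Fin N → ℂ) (e : ℂ)
    (hh : ∀ k, hF mu lam (lam k + e) ≠ 0) (hS : ∀ k, sF mu lam e k ≠ 1) :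
    (blockM mu lam e).det = (∏ k, (1 - sF mu lam e k)) * (aM mu lam e).det := by
  have hS' : ∀ k, 1 - sF mu lam e k ≠ 0 := fun k => sub_ne_zero.2 (hS k).symm
  have key : Matrix.diagonal (fun k => hF mu lam (lam k + e) * (1 - sF mu lam e k)) * aM mu lam e
      = blockM mu lam e * Matrix.diagonal (fun k => hF mu lam (lam k + e)) := by
    ext l k
    rw [Matrix.diagonal_mul, Matrix.mul_diagonal, aM, blockM, Matrix.add_apply, Matrix.add_apply,
      Matrix.of_apply, Matrix.of_apply]
    have h1 := hh k
    have h2 := hh l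
    have h3 := hS' l
    by_cases hlk : l = k
    · subst hlk
      rw [Matrix.one_apply_eq, Matrix.diagonal_apply_eq]
      field_simp
    · rw [Matrix.one_apply_ne hlk, Matrix.diagonal_apply_ne _ hlk]
      field_simp
      ring
  have := congrArg Matrix.det key
  rw [Matrix.det_mul, Matrix.det_mul, Matrix.det_diagonal, Matrix.det_diagonal,
    Finset.prod_mul_distrib] at this
  have hp : ∏ k, hF mu lam (lam k + e) ≠ 0 := Finset.prod_ne_zero_iff.2 fun k _ => hh k
  apply mul_right_cancel₀ hp
  rw [← this]; ring

/-- the deformed matrix -/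
noncomputable def tM {N : ℕ} (mu : Fin (N + 1) → ℂ) (lam : Fin N → ℂ) (e ν : ℂ) :
    Matrix (Fin N) (Fin N) ℂ :=
  1 + Matrix.of fun l k => rF mu lam l / (hF mu lam (lam l + e) * (1 - sF mu lam e l)) *
    ((ν - lam l - e) / (ν - lam k - e) *
      (kapF lam e l k - 2 * e / ((lam l - ν) * (lam l - (ν - e)))))

lemma det_tM {N : ℕ} (mu : Fin (N + 1) → ℂ) (lam : Fin N → ℂ) (e ν : ℂ) (he : e ≠ 0)
    (hl : Function.Injective lam)
    (hlp : ∀ k l, lam k + e ≠ lam l) (hlm : ∀ k l, lam k - e ≠ lam l)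
    (hν : ∀ p, ν ≠ lam p) (hνe : ∀ p, ν - e ≠ lam p)
    (hh : ∀ k, hF mu lam (lam k + e) ≠ 0) (hS : ∀ k, sF mu lam e k ≠ 1) :
    (tM mu lam e ν).det = (hF mu lam ν - hF mu lam (ν - e)) / e * (aM mu lam e).det := by
  have hS' : ∀ k, 1 - sF mu lam e k ≠ 0 := fun k => sub_ne_zero.2 (hS k).symm
  have hn : ∀ k, ν - lam k - e ≠ 0 := fun k h => hνe k (by linear_combination h)
  set x : Fin N → ℂ := fun l => (1 - sF mu lam e l) * hF mu lam (lam l + e) / (2 * e) with hx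
  set q : Fin N → ℂ := fun l => rF mu lam l / (hF mu lam (lam l + e) * (1 - sF mu lam e l)) *
    (2 * e / ((lam l - ν) * (lam l - (ν - e)))) with hq
  have hxA : ∀ k, ∑ l, x l * aM mu lam e l k = 1 := by
    intro k
    have h0 := pf2 mu lam hl (lam k + e) (lam k - e)
      (fun h => he (by linear_combination h / 2)) (hlp k) (hlm k)
    rw [show lam k + e - (lam k - e) = 2 * e by ring] at h0
    have h1 : ∀ l, x l * aM mu lam e l k = x l * (1 : Matrix (Fin N) (Fin N) ℂ) l k
        + rF mu lam l / ((lam l - (lam k + e)) * (lam l - (lam k - e))) := by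
      intro l
      rw [aM, Matrix.add_apply, mul_add, Matrix.of_apply]
      congr 1
      have a1 := hh l
      have a2 := hS' l
      rw [hx, kapF]
      field_simp
    rw [Finset.sum_congr rfl fun l _ => h1 l, Finset.sum_add_distrib, h0]
    have h2 : ∑ l, x l * (1 : Matrix (Fin N) (Fin N) ℂ) l k = x k := by
      simp [Matrix.one_apply]
    rw [h2, hx]
    have a1 := hh k
    simp only [sF]
    field_simp
    ring
  have key1 : tM mu lam e ν * Matrix.diagonal (fun k => ν - lam k - e)
      = Matrix.diagonal (fun k => ν - lam k - e) *
        ((1 - Matrix.replicateCol Unit q * Matrix.replicateRow Unit x) * aM mu lam e) := by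
    ext l k
    rw [Matrix.diagonal_mul, Matrix.mul_diagonal, Matrix.sub_mul, Matrix.one_mul, Matrix.sub_apply,
      Matrix.mul_assoc]
    have : (Matrix.replicateCol Unit q * (Matrix.replicateRow Unit x * aM mu lam e)) l k = q l := by
      have := hxA k
      simp [Matrix.mul_apply, this]
    rw [this, tM, aM, Matrix.add_apply, Matrix.add_apply, Matrix.of_apply, Matrix.of_apply, hq]
    have b1 := hn k
    beta_reduce
    generalize rF mu lam l / (hF mu lam (lam l + e) * (1 - sF mu lam e l)) = G
    generalize 2 * e / ((lam l - ν) * (lam l - (ν - e))) = W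
    by_cases hlk : l = k
    · subst hlk
      rw [Matrix.one_apply_eq]
      field_simp
      ring
    · rw [Matrix.one_apply_ne hlk]
      field_simp
      ring
  have hxq : ∑ l, x l * q l = 1 - (hF mu lam ν - hF mu lam (ν - e)) / e := by
    have h0 := pf2 mu lam hl ν (ν - e)
      (fun h => he (by linear_combination h)) hν hνe
    rw [show ν - (ν - e) = e by ring] at h0
    rw [← h0]
    refine Finset.sum_congr rfl fun l _ => ?_
    have a1 := hh l
    have a2 := hS' l
    rw [hx, hq]
    field_simp
  have key2 : (1 - Matrix.replicateCol Unit q * Matrix.replicateRow Unit x).det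
      = (hF mu lam ν - hF mu lam (ν - e)) / e := by
    rw [Matrix.det_one_sub_mul_comm, Matrix.det_unique, Matrix.sub_apply, Matrix.one_apply_eq]
    simp only [Matrix.mul_apply, Matrix.replicateCol_apply, Matrix.replicateRow_apply]
    rw [hxq]; ring
  have := congrArg Matrix.det key1
  rw [Matrix.det_mul, Matrix.det_mul, Matrix.det_mul, key2, Matrix.det_diagonal, mul_comm] at this
  exact mul_left_cancel₀ (Finset.prod_ne_zero_iff.2 fun k _ => hn k) this

noncomputable def bM {N : ℕ} (mu : Fin (N + 1) → ℂ) (lam : Fin N → ℂ) (e ν : ℂ) :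
    Matrix (Fin (N + 1)) (Fin (N + 1)) ℂ :=
  Matrix.of fun j k => Fin.lastCases (motive := fun _ => ℂ)
    (1 / (mu j - ν) - 1 / (mu j - (ν - e)))
    (fun k => (1 - sF mu lam e k) / (mu j - lam k) - 1 / (mu j - (lam k + e))
      + sF mu lam e k / (mu j - (lam k - e))) k

noncomputable def xM {N : ℕ} (mu : Fin (N + 1) → ℂ) (lam : Fin N → ℂ) (e ν : ℂ) :
    Matrix (Fin (N + 1)) (Fin (N + 1)) ℂ :=
  Matrix.of fun l k => Fin.lastCases (motive := fun _ => ℂ)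
    (Fin.lastCases (motive := fun _ => ℂ) (1 - hF mu lam ν / hF mu lam (ν - e))
      (fun l => - (rF mu lam l / (lam l - ν) * (ν - e - ν) / (ν - e - lam l) / hF mu lam (ν - e))) l)
    (fun k => Fin.lastCases (motive := fun _ => ℂ) 0 (fun l => blockM mu lam e l k) l) k

noncomputable def cM {N : ℕ} (mu : Fin (N + 1) → ℂ) (lam : Fin N → ℂ) (ν : ℂ) :
    Matrix (Fin (N + 1)) (Fin (N + 1)) ℂ :=
  Matrix.of fun j k => 1 / (mu j - (Fin.snoc lam ν : Fin (N + 1) → ℂ) k)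

lemma det_xM {N : ℕ} (mu : Fin (N + 1) → ℂ) (lam : Fin N → ℂ) (e ν : ℂ) :
    (xM mu lam e ν).det = (1 - hF mu lam ν / hF mu lam (ν - e)) * (blockM mu lam e).det := by
  rw [Matrix.det_succ_row _ (Fin.last N), Fin.sum_univ_castSucc]
  have : (xM mu lam e ν).submatrix (Fin.last N).succAbove (Fin.last N).succAbove
      = blockM mu lam e := by
    ext l k
    simp [xM]
  rw [this]
  simp [xM, ← two_mul]

lemma bM_eq {N : ℕ} (mu : Fin (N + 1) → ℂ) (lam : Fin N → ℂ) (e ν : ℂ)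
    (hl : Function.Injective lam) (hml : ∀ a p, mu a ≠ lam p)
    (hlp : ∀ k l, lam k + e ≠ lam l) (hlm : ∀ k l, lam k - e ≠ lam l)
    (hmp : ∀ k a, lam k + e ≠ mu a) (hmm : ∀ k a, lam k - e ≠ mu a)
    (hν : ∀ p, ν ≠ lam p) (hνe : ∀ p, ν - e ≠ lam p)
    (hνm : ∀ p, ν ≠ mu p) (hνem : ∀ p, ν - e ≠ mu p) :
    bM mu lam e ν = cM mu lam ν * xM mu lam e ν := by
  ext j k
  rw [Matrix.mul_apply, Fin.sum_univ_castSucc]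
  induction k using Fin.lastCases with
  | last =>
    simp only [bM, cM, xM, Matrix.of_apply, Fin.lastCases_last, Fin.lastCases_castSucc,
      Fin.snoc_castSucc, Fin.snoc_last]
    rw [pf1 mu lam hl hml ν (ν - e) hν hνm hνe hνem j]
    simp only [mul_neg, Finset.sum_neg_distrib]
    ring
  | cast k =>
    simp only [bM, cM, xM, Matrix.of_apply, Fin.lastCases_last, Fin.lastCases_castSucc,
      Fin.snoc_castSucc, Fin.snoc_last]
    have p1 := pf1 mu lam hl hml ν (lam k + e) hν hνm (hlp k) (hmp k) j
    have p2 := pf1 mu lam hl hml ν (lam k - e) hν hνm (hlm k) (hmm k) j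
    have hH1 := hF_ne mu lam (lam k + e) (hlp k) (hmp k)
    have hH2 := hF_ne mu lam (lam k - e) (hlm k) (hmm k)
    have e1 : ∑ l, 1 / (mu j - lam l) * blockM mu lam e l k
        = (1 - sF mu lam e k) / (mu j - lam k) -
          ∑ l, 1 / (mu j - lam l) *
            (rF mu lam l / (lam l - ν) * (lam k + e - ν) / (lam k + e - lam l) /
              hF mu lam (lam k + e))
          + sF mu lam e k * ∑ l, 1 / (mu j - lam l) *
            (rF mu lam l / (lam l - ν) * (lam k - e - ν) / (lam k - e - lam l) /
              hF mu lam (lam k - e)) := by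
      have e2 : (1 - sF mu lam e k) / (mu j - lam k) = ∑ l, 1 / (mu j - lam l) *
          Matrix.diagonal (fun k => 1 - sF mu lam e k) l k := by
        simp [Matrix.diagonal_apply]
        ring
      rw [e2, Finset.mul_sum, ← Finset.sum_sub_distrib, ← Finset.sum_add_distrib]
      refine Finset.sum_congr rfl fun l _ => ?_
      rw [blockM, Matrix.add_apply, Matrix.of_apply, kapF, sF]
      have b1 := sub_ne_zero.2 (hlp k l)
      have b2 := sub_ne_zero.2 (hlm k l)
      have b3 := sub_ne_zero.2 (hν l).symm
      have b4 := sub_ne_zero.2 (hml j l)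
      rw [show lam l - (lam k + e) = -(lam k + e - lam l) by ring,
        show lam l - (lam k - e) = -(lam k - e - lam l) by ring]
      generalize Matrix.diagonal (fun k => 1 - sF mu lam e k) l k = D
      generalize hF mu lam (lam k + e) = H1 at *
      generalize hF mu lam (lam k - e) = H2 at *
      field_simp
      ring
    rw [e1, p1, show sF mu lam e k / (mu j - (lam k - e))
      = sF mu lam e k * (1 / (mu j - (lam k - e))) by ring, p2]
    have e3 : hF mu lam ν / hF mu lam (lam k + e)
        = sF mu lam e k * (hF mu lam ν / hF mu lam (lam k - e)) := by
      rw [sF]; field_simp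
    rw [e3]
    ring

lemma shiftS_eq (c : ℝ) (N : ℕ) (mu : Fin (N + 1) → ℂ) (lam : Fin N → ℂ) (k : Fin N) :
    shiftS c N mu lam (lam k) = sF mu lam (Complex.I * c) k := by
  rw [shiftS, sF, hF, hF]
  generalize Complex.I * (c : ℂ) = e
  have h1 : ∀ a, (mu a - lam k + e) / (mu a - lam k - e)
      = (lam k - e - mu a) / (lam k + e - mu a) := fun a => by
    rw [← neg_div_neg_eq]; congr 1 <;> ring
  have h2 : ∀ a, (lam a - lam k - e) / (lam a - lam k + e)
      = (lam k + e - lam a) / (lam k - e - lam a) := fun a => by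
    rw [← neg_div_neg_eq]; congr 1 <;> ring
  simp only [h1, h2, Finset.prod_div_distrib]
  rw [div_div_div_eq, div_mul_div_comm]
  congr 1; ring

lemma kMod_eq (c : ℝ) (ν x y : ℂ)
    (h1 : x - (y + Complex.I * c) ≠ 0) (h2 : x - (y - Complex.I * c) ≠ 0)
    (h3 : ν - x ≠ 0) (h4 : ν - x - Complex.I * c ≠ 0) (h5 : ν - y - Complex.I * c ≠ 0) :
    Complex.I * kMod c ν x y = (ν - x - Complex.I * c) / (ν - y - Complex.I * c) *
      (2 * (Complex.I * c) / ((x - (y + Complex.I * c)) * (x - (y - Complex.I * c)))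
        - 2 * (Complex.I * c) / ((x - ν) * (x - (ν - Complex.I * c)))) := by
  have hc2 : (c : ℂ) = -Complex.I * (Complex.I * c) := by
    linear_combination (c : ℂ) * Complex.I_mul_I
  have hcc : (c : ℂ) ^ 2 = -(Complex.I * c) ^ 2 := by
    linear_combination (c : ℂ) ^ 2 * Complex.I_mul_I
  have h0 : 2 * (c : ℂ) = -Complex.I * (2 * (Complex.I * c)) := by
    linear_combination (2 * (c : ℂ)) * Complex.I_mul_I
  rw [kMod, hcc, h0]
  generalize Complex.I * (c : ℂ) = e at *
  have e1 : (x - y) ^ 2 + -e ^ 2 = (x - (y + e)) * (x - (y - e)) := by ring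
  have e2 : x - y + e = x - (y - e) := by ring
  have e3 : x - ν + e = -(ν - x - e) := by ring
  have e4 : x - ν = -(ν - x) := by ring
  have e5 : x - (ν - e) = -(ν - x - e) := by ring
  rw [e1, e2, e3, e4, e5]
  have hI : Complex.I ^ 2 = -1 := Complex.I_sq
  have : ∀ A B : ℂ, Complex.I * (A * (-Complex.I * (2 * e) / ((x - (y + e)) * (x - (y - e))) -
      Complex.I * B)) = A * (2 * e / ((x - (y + e)) * (x - (y - e))) + B) := by
    intro A B
    linear_combination (-A * (2 * e / ((x - (y + e)) * (x - (y - e))) + B)) * hI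
  rw [mul_assoc Complex.I (1 - _), this]
  field_simp
  ring

lemma tM_eq (c : ℝ) (N : ℕ) (mu : Fin (N + 1) → ℂ) (lam : Fin N → ℂ) (ν : ℂ)
    (hlp : ∀ k l, lam k + Complex.I * c ≠ lam l) (hlm : ∀ k l, lam k - Complex.I * c ≠ lam l)
    (hν : ∀ p, ν ≠ lam p) (hνe : ∀ p, ν - Complex.I * c ≠ lam p) :
    (1 : Matrix (Fin N) (Fin N) ℂ) +
              Matrix.of (fun j k : Fin N =>
                -Complex.I *
                    (∏ a : Fin (N + 1),
                      (lam j - mu a) /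
                        (lam j - mu a + Complex.I * (c : ℂ))) *
                    ((∏ a : Fin N, (lam j - lam a + Complex.I * (c : ℂ))) /
                      (∏ a ∈ Finset.univ.erase j, (lam j - lam a))) *
                    (kMod c ν (lam j) (lam k) /
                      (shiftS c N mu lam (lam j) - 1))) = tM mu lam (Complex.I * c) ν := by
  rw [tM]
  congr 1
  ext j k
  rw [Matrix.of_apply, Matrix.of_apply, shiftS_eq, kapF,
    ← kMod_eq c ν (lam j) (lam k) (sub_ne_zero.2 (hlp k j).symm) (sub_ne_zero.2 (hlm k j).symm)
      (sub_ne_zero.2 (hν j)) (fun h => hνe j (by linear_combination h))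
      (fun h => hνe k (by linear_combination h)), rF, hF, Finset.prod_div_distrib]
  have h1 : ∀ a, lam j - mu a + Complex.I * c = lam j + Complex.I * c - mu a := fun a => by ring
  have h2 : ∀ a, lam j - lam a + Complex.I * c = lam j + Complex.I * c - lam a := fun a => by ring
  simp only [h1, h2]
  rw [show sF mu lam (Complex.I * c) j - 1 = -(1 - sF mu lam (Complex.I * c) j) by ring]
  simp only [div_eq_mul_inv, mul_inv, inv_inv, inv_neg]
  ring

lemma bethe_eq (N : ℕ) (lam : Fin N → ℂ) (e A D : ℂ) (he : e ≠ 0) (hA : A ≠ 0) (k : Fin N)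
    (h : D / A = ∏ p ∈ Finset.univ.erase k, (lam k - lam p + e) / (lam k - lam p - e)) :
    D = -A * ∏ p, (lam p - lam k - e) / (lam p - lam k + e) := by
  rw [div_eq_iff hA] at h
  rw [h, ← Finset.mul_prod_erase _ _ (Finset.mem_univ k)]
  have h2 : ∀ a, (lam a - lam k - e) / (lam a - lam k + e)
      = (lam k - lam a + e) / (lam k - lam a - e) := fun a => by
    rw [← neg_div_neg_eq]; congr 1 <;> ring
  simp only [h2]
  have : (lam k - lam k + e) / (lam k - lam k - e) = -1 := by
    rw [sub_self, zero_add, zero_sub, div_neg, div_self he]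
  rw [this]; ring

lemma tFn_eq (c : ℝ) (l m : ℂ) (h1 : l - m ≠ 0) (h2 : l - m - Complex.I * c ≠ 0) :
    tFn c l m = 1 / (l - m) - 1 / (l - m - Complex.I * c) := by
  rw [tFn]; field_simp; ring

/-- factorization of the (N+1)×(N+1) Slavnov determinant for the lattice
form factor of the conjugated field: extraction of a Cauchy determinant and reduction to
an N×N determinant of the form det(I + U^{(Δ)}). -/
theorem lattice_form_factor_determinant_factorization
    (c L : ℝ) (hc : 0 < c) (hL : 0 < L) (M : ℕ) (hM : Even M) (hMpos : 0 < M)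
    (Δ : ℝ) (hΔdef : Δ = L / M) (hΔpos : 0 < Δ) (hΔ : Δ < 4 / c)
    (N : ℕ)
    (lam : Fin N → ℝ) (hlam : Function.Injective lam)
    (mu : Fin (N + 1) → ℝ) (hmu : Function.Injective mu)
    (hlamBethe : ∀ r : Fin N,
      dLat c Δ M ((lam r : ℂ)) / aLat c Δ M ((lam r : ℂ))
        = ∏ p ∈ Finset.univ.erase r,
            ((lam r : ℂ) - (lam p : ℂ) + Complex.I * (c : ℂ)) /
              ((lam r : ℂ) - (lam p : ℂ) - Complex.I * (c : ℂ)))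
    (hmuBethe : ∀ r : Fin (N + 1),
      dLat c Δ M ((mu r : ℂ)) / aLat c Δ M ((mu r : ℂ))
        = ∏ p ∈ Finset.univ.erase r,
            ((mu r : ℂ) - (mu p : ℂ) + Complex.I * (c : ℂ)) /
              ((mu r : ℂ) - (mu p : ℂ) - Complex.I * (c : ℂ)))
    (hne : ∀ (a : Fin (N + 1)) (b : Fin N), mu a ≠ lam b)
    (hS : ∀ j : Fin N,
      shiftS c N (fun a => (mu a : ℂ)) (fun a => (lam a : ℂ)) ((lam j : ℂ)) ≠ 1) :
    -- ν := −2i/Δ + ic/2 and the extended tuple λ' with λ'_{N+1} = ν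
    ∀ (ν : ℂ), ν = -2 * Complex.I / (Δ : ℂ) + Complex.I * (c : ℂ) / 2 →
    ∀ (lam' : Fin (N + 1) → ℂ), lam' = Fin.snoc (fun a => ((lam a : ℝ) : ℂ)) ν →
      Matrix.det (Matrix.of fun j k : Fin (N + 1) =>
          aLat c Δ M (lam' k) * tFn c ((mu j : ℂ)) (lam' k) *
              (∏ a : Fin (N + 1), ((mu a : ℂ) - lam' k - Complex.I * (c : ℂ)))
            - dLat c Δ M (lam' k) * tFn c (lam' k) ((mu j : ℂ)) *
              (∏ a : Fin (N + 1), ((mu a : ℂ) - lam' k + Complex.I * (c : ℂ))))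
        = (aLat c Δ M ν * (∏ k : Fin (N + 1), (lam' k - ν - Complex.I * (c : ℂ)))
              + dLat c Δ M ν * (∏ k : Fin (N + 1), (lam' k - ν + Complex.I * (c : ℂ)))) *
          (∏ k : Fin N,
            aLat c Δ M ((lam k : ℂ)) *
              (∏ a : Fin (N + 1), ((mu a : ℂ) - (lam k : ℂ) - Complex.I * (c : ℂ))) *
              (1 - shiftS c N (fun a => (mu a : ℂ)) (fun a => (lam a : ℂ)) ((lam k : ℂ)))) *
          Matrix.det (Matrix.of fun j k : Fin (N + 1) => 1 / ((mu j : ℂ) - lam' k)) *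
          Matrix.det
            ((1 : Matrix (Fin N) (Fin N) ℂ) +
              Matrix.of (fun j k : Fin N =>
                -Complex.I *
                    (∏ a : Fin (N + 1),
                      ((lam j : ℂ) - (mu a : ℂ)) /
                        ((lam j : ℂ) - (mu a : ℂ) + Complex.I * (c : ℂ))) *
                    ((∏ a : Fin N, ((lam j : ℂ) - (lam a : ℂ) + Complex.I * (c : ℂ))) /
                      (∏ a ∈ Finset.univ.erase j, ((lam j : ℂ) - (lam a : ℂ)))) *
                    (kMod c ν ((lam j : ℂ)) ((lam k : ℂ)) /
                      (shiftS c N (fun a => (mu a : ℂ)) (fun a => (lam a : ℂ))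
                          ((lam j : ℂ)) - 1)))) := by
  intro ν hν lam' hlam'
  set lamC : Fin N → ℂ := fun a => (lam a : ℂ) with hlamC
  set muC : Fin (N + 1) → ℂ := fun a => (mu a : ℂ) with hmuC
  set e : ℂ := Complex.I * (c : ℂ) with he_def
  have hcC : (c : ℂ) ≠ 0 := by exact_mod_cast hc.ne'
  have he : e ≠ 0 := mul_ne_zero Complex.I_ne_zero hcC
  have heim : e.im = c := by simp [he_def]
  have hΔC : (Δ : ℂ) ≠ 0 := by exact_mod_cast hΔpos.ne'
  have hνim : ν.im < 0 := by
    have h1 : ν = ((-2 / Δ + c / 2 : ℝ) : ℂ) * Complex.I := by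
      rw [hν]; push_cast; ring
    rw [h1, Complex.im_ofReal_mul, Complex.I_im, mul_one]
    have h2 : c * Δ < 4 := by
      rw [lt_div_iff₀ hc] at hΔ; linarith
    have h3 : c < 4 / Δ := by rw [lt_div_iff₀ hΔpos]; exact h2
    have h4 : (4 : ℝ) / Δ = 2 * (2 / Δ) := by ring
    have h5 : -2 / Δ = -(2 / Δ) := by ring
    linarith
  have hl : Function.Injective lamC := fun a b h => hlam (Complex.ofReal_injective h)
  have hml : ∀ a p, muC a ≠ lamC p := fun a p h => hne a p (Complex.ofReal_injective h)
  have him : ∀ x : ℝ, ∀ z : ℂ, z.im ≠ 0 → z ≠ (x : ℂ) := fun x z hz h => hz (by rw [h]; simp)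
  have hpim : ∀ k, (lamC k + e).im ≠ 0 := fun k => by simp [hlamC, heim, hc.ne']
  have hmim : ∀ k, (lamC k - e).im ≠ 0 := fun k => by simp [hlamC, heim, hc.ne']
  have hneim : (ν - e).im ≠ 0 := by rw [Complex.sub_im, heim]; linarith
  have hlp : ∀ k l, lamC k + e ≠ lamC l := fun k l => him _ _ (hpim k)
  have hlm : ∀ k l, lamC k - e ≠ lamC l := fun k l => him _ _ (hmim k)
  have hmp : ∀ k a, lamC k + e ≠ muC a := fun k l => him _ _ (hpim k)
  have hmm : ∀ k a, lamC k - e ≠ muC a := fun k l => him _ _ (hmim k)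
  have hν1 : ∀ p, ν ≠ lamC p := fun p => him _ _ hνim.ne
  have hνm : ∀ p, ν ≠ muC p := fun p => him _ _ hνim.ne
  have hνe : ∀ p, ν - e ≠ lamC p := fun p => him _ _ hneim
  have hνem : ∀ p, ν - e ≠ muC p := fun p => him _ _ hneim
  have hSe : ∀ k, shiftS c N muC lamC (lamC k) = sF muC lamC e k := fun k => shiftS_eq c N muC lamC k
  have hS1 : ∀ k, sF muC lamC e k ≠ 1 := fun k => by rw [← hSe]; exact hS k
  have hh : ∀ k, hF muC lamC (lamC k + e) ≠ 0 := fun k => hF_ne _ _ _ (hlp k) (hmp k)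
  have haν : aLat c Δ M ν = 0 := by
    have hM2 : M / 2 ≠ 0 := by obtain ⟨m, rfl⟩ := hM; omega
    have : -Complex.I * ν * (Δ : ℂ) / 2 + 1 - (c : ℂ) * (Δ : ℂ) / 4 = 0 := by
      rw [hν, he_def]; field_simp
      linear_combination 4 * (4 - (c : ℂ) * Δ) * Complex.I_sq
    rw [aLat, this, zero_pow hM2, mul_zero]
  have hA : ∀ k, aLat c Δ M (lamC k) ≠ 0 := by
    intro k h
    have h1 := hlamBethe k
    rw [show aLat c Δ M ((lam k : ℝ) : ℂ) = 0 from h, div_zero] at h1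
    refine absurd h1.symm (Finset.prod_ne_zero_iff.2 fun p _ => div_ne_zero ?_ ?_)
    · intro h2; exact hlp k p (by linear_combination h2)
    · intro h2; exact hlm k p (by linear_combination h2)
  have hD : ∀ k, dLat c Δ M (lamC k) * ∏ a, (muC a - lamC k + e)
      = -sF muC lamC e k * (aLat c Δ M (lamC k) * ∏ a, (muC a - lamC k - e)) := by
    intro k
    rw [bethe_eq N lamC e _ _ he (hA k) k (hlamBethe k), ← hSe, shiftS]
    simp only [Finset.prod_div_distrib]
    have : ∏ a, (muC a - lamC k - e) ≠ 0 := Finset.prod_ne_zero_iff.2 fun a _ h =>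
      hmp k a (by linear_combination -h)
    rw [← he_def]
    field_simp
  set al : Fin (N + 1) → ℂ := fun k => Fin.lastCases (motive := fun _ => ℂ)
    (dLat c Δ M ν * ∏ a, (muC a - (ν - e)))
    (fun k => aLat c Δ M (lamC k) * ∏ a, (muC a - lamC k - e)) k with hal
  have hΩ : (Matrix.of fun j k : Fin (N + 1) =>
          aLat c Δ M (lam' k) * tFn c ((mu j : ℂ)) (lam' k) *
              (∏ a : Fin (N + 1), ((mu a : ℂ) - lam' k - e))
            - dLat c Δ M (lam' k) * tFn c (lam' k) ((mu j : ℂ)) *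
              (∏ a : Fin (N + 1), ((mu a : ℂ) - lam' k + e)))
      = Matrix.of fun j k => al k * bM muC lamC e ν j k := by
    ext j k
    rw [Matrix.of_apply, Matrix.of_apply]
    induction k using Fin.lastCases with
    | last =>
      simp only [hlam', Fin.snoc_last, hal, bM, Matrix.of_apply, Fin.lastCases_last]
      have a1 := sub_ne_zero.2 (hνm j)
      have a2 : ν - muC j - e ≠ 0 := fun h => hνem j (by linear_combination h)
      rw [haν, show ((mu j : ℝ) : ℂ) = muC j from rfl, tFn_eq c ν (muC j) a1 a2, ← he_def]
      have a3 : ∀ a, muC a - (ν - e) = muC a - ν + e := fun a => by ring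
      simp only [a3]
      rw [show muC j - ν + e = -(ν - muC j - e) by ring, show muC j - ν = -(ν - muC j) by ring]
      simp only [div_neg]
      ring
    | cast k =>
      simp only [hlam', Fin.snoc_castSucc, hal, bM, Matrix.of_apply, Fin.lastCases_castSucc]
      have a1 := sub_ne_zero.2 (hml j k)
      have a2 : muC j - lamC k - e ≠ 0 := fun h => hmp k j (by linear_combination -h)
      have a3 := sub_ne_zero.2 (hml j k).symm
      have a4 : lamC k - muC j - e ≠ 0 := fun h => hmm k j (by linear_combination h)
      rw [show ((mu j : ℝ) : ℂ) = muC j from rfl, tFn_eq c (muC j) (lamC k) a1 a2,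
        tFn_eq c (lamC k) (muC j) a3 a4, ← he_def]
      rw [show lamC k - muC j - e = -(muC j - (lamC k - e)) by ring,
        show lamC k - muC j = -(muC j - lamC k) by ring,
        show muC j - (lamC k + e) = muC j - lamC k - e by ring]
      simp only [div_neg]
      linear_combination (1 / (muC j - lamC k) - 1 / (muC j - (lamC k - e))) * hD k
  have hprod : ∏ k, al k = (dLat c Δ M ν * ∏ a, (muC a - (ν - e))) *
      ∏ k, (aLat c Δ M (lamC k) * ∏ a, (muC a - lamC k - e)) := by
    rw [Fin.prod_univ_castSucc]
    simp only [hal, Fin.lastCases_last, Fin.lastCases_castSucc]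
    ring
  have hTM := tM_eq c N muC lamC ν hlp hlm hν1 hνe
  rw [← he_def] at hTM
  have hdt := det_tM muC lamC e ν he hl hlp hlm hν1 hνe hh hS1
  have hCM : (Matrix.of fun j k : Fin (N + 1) => 1 / ((mu j : ℂ) - lam' k)) = cM muC lamC ν := by
    rw [hlam']; rfl
  have hfin : (∏ a, (muC a - (ν - e))) * (1 - hF muC lamC ν / hF muC lamC (ν - e))
      = (∏ p, (lamC p - (ν - e))) * (hF muC lamC ν - hF muC lamC (ν - e)) := by
    have h0 := hF_ne muC lamC (ν - e) hνe hνem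
    have h1 : ∏ p, (ν - e - lamC p) ≠ 0 := Finset.prod_ne_zero_iff.2 fun p _ =>
      sub_ne_zero.2 (hνe p)
    have h2 : ∏ a, (muC a - (ν - e)) = -(∏ p, (lamC p - (ν - e))) * hF muC lamC (ν - e) := by
      have e1 : ∀ a, muC a - (ν - e) = -1 * (ν - e - muC a) := fun a => by ring
      have e2 : ∀ a, lamC a - (ν - e) = -1 * (ν - e - lamC a) := fun a => by ring
      simp only [e1, e2, Finset.prod_mul_distrib, hF]
      simp only [Finset.prod_const, Finset.card_univ, Fintype.card_fin]
      field_simp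
      ring
    rw [h2]
    field_simp
    ring
  have hY : (aLat c Δ M ν * (∏ k : Fin (N + 1), (lam' k - ν - e))
              + dLat c Δ M ν * (∏ k : Fin (N + 1), (lam' k - ν + e)))
      = dLat c Δ M ν * ((∏ p, (lamC p - (ν - e))) * e) := by
    rw [haν, zero_mul, zero_add, Fin.prod_univ_castSucc, hlam']
    simp only [Fin.snoc_castSucc, Fin.snoc_last]
    have e2 : ∀ a, lamC a - (ν - e) = lamC a - ν + e := fun a => by ring
    simp only [e2, sub_self, zero_add]
  have hbm := congrArg Matrix.det (bM_eq muC lamC e ν hl hml hlp hlm hmp hmm hν1 hνe hνm hνem)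
  rw [Matrix.det_mul, det_xM, det_blockM muC lamC e hh hS1] at hbm
  refine (congrArg Matrix.det hΩ).trans ?_
  rw [Matrix.det_mul_row, hprod, hbm, hY, hCM]
  refine Eq.trans ?_ (congrArg (fun t => _ * Matrix.det t) hTM).symm
  rw [hdt]
  have hS2 : ∀ k : Fin N, shiftS c N muC lamC ((lam k : ℝ) : ℂ) = sF muC lamC e k := hSe
  simp only [hS2]
  rw [Finset.prod_mul_distrib, Finset.prod_mul_distrib, Finset.prod_mul_distrib]
  have : (∏ p, (lamC p - (ν - e))) * e * ((hF muC lamC ν - hF muC lamC (ν - e)) / e)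
     = (∏ a, (muC a - (ν - e))) * (1 - hF muC lamC ν / hF muC lamC (ν - e)) := by
    rw [hfin]; field_simp
  linear_combination (-(dLat c Δ M ν) * (∏ k, aLat c Δ M (lamC k)) *
    (∏ k, ∏ a, (muC a - lamC k - e)) * (∏ k, (1 - sF muC lamC e k)) *
    (cM muC lamC ν).det * (aM muC lamC e).det) * this
end

section
/- Let N ≥ 1, let M ≥ 2 be an even integer, Δ > 0, c a complex number, λ_1,…,λ_N complex numbers, σ a permutation of {1,…,N}, and 1 ≤ n_1 ≤ … ≤ n_N ≤ M integers. Set Z_m := 1 + (−1)^m·cΔ/4, α(λ) := (1 − cΔ/4 + iλΔ/2)(1 + cΔ/4 + iλΔ/2), ᾱ(λ) := α(−λ), and A_k := {a ∈ {1,…,N} : n_{σ^{-1}(a)} = k}. Then ∏_{ℓ=2}^{M} ∏_{m=1}^{ℓ−1} [ ∏_{a ∈ A_ℓ} (Z_m + iΔλ_a/2) · ∏_{b ∈ A_m} (Z_ℓ − iΔλ_b/2) ] = ∏_{a=1}^{N} α(λ_{σ(a)})^{⌊(n_a−1)/2⌋} · ᾱ(λ_{σ(a)})^{⌊(M−n_a)/2⌋}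 · ∏_{a=1}^{N} (1 − (−1)^{n_a}·Δ·(c/4 − iλ_{σ(a)}/2)). -/
open scoped BigOperators

/-- Product of an alternating function over whole odd/even pairs. -/
lemma pair_prod (h : ℕ → ℂ) (p q : ℂ) (hp : ∀ j, h (2 * j + 1) = p) (hq : ∀ j, h (2 * j + 2) = q)
    (s t : ℕ) : ∏ m ∈ Finset.Ico (2 * s + 1) (2 * s + 2 * t + 1), h m = (p * q) ^ t := by
  induction t with
  | zero => simp
  | succ t ih =>
    have e : 2 * s + 2 * (t + 1) + 1 = (2 * s + 2 * t + 1) + 1 + 1 := by ring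
    rw [e, Finset.prod_Ico_succ_top (by omega), Finset.prod_Ico_succ_top (by omega), ih]
    have h1 := hp (s + t)
    have h2 := hq (s + t)
    rw [show 2 * (s + t) + 1 = 2 * s + 2 * t + 1 by ring] at h1
    rw [show 2 * (s + t) + 2 = 2 * s + 2 * t + 1 + 1 by ring] at h2
    rw [h1, h2]; ring

/-- The contribution of one particle at site `k`. -/
lemma cell_one (M k : ℕ) (hMe : Even M) (hk : 1 ≤ k) (hkM : k ≤ M) (y x : ℂ) :
    (∏ m ∈ Finset.Icc 1 (k - 1), (1 + (-1 : ℂ) ^ m * y + x)) *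
      (∏ l ∈ Finset.Icc (k + 1) M, (1 + (-1 : ℂ) ^ l * y - x))
    = ((1 - y + x) * (1 + y + x)) ^ ((k - 1) / 2) * ((1 - y - x) * (1 + y - x)) ^ ((M - k) / 2)
      * (1 - (-1 : ℂ) ^ k * (y - x)) := by
  have ho : ∀ j : ℕ, (-1 : ℂ) ^ (2 * j + 1) = -1 := fun j => by simp [pow_succ, pow_mul]
  have he : ∀ j : ℕ, (-1 : ℂ) ^ (2 * j + 2) = 1 := fun j => by simp [pow_succ, pow_mul]
  have A := pair_prod (fun m => 1 + (-1 : ℂ) ^ m * y + x) (1 - y + x) (1 + y + x)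
    (fun j => by simp only [ho]; ring) (fun j => by simp only [he]; ring)
  have B := pair_prod (fun m => 1 + (-1 : ℂ) ^ m * y - x) (1 - y - x) (1 + y - x)
    (fun j => by simp only [ho]; ring) (fun j => by simp only [he]; ring)
  have I1 : Finset.Icc 1 (k - 1) = Finset.Ico 1 k := by ext; simp; omega
  have I2 : Finset.Icc (k + 1) M = Finset.Ico (k + 1) (M + 1) := by ext; simp
  rw [I1, I2]
  obtain ⟨r, hr⟩ := hMe
  rcases Nat.even_or_odd' k with ⟨s, hs | hs⟩
  · obtain ⟨s, rfl⟩ : ∃ s', s = s' + 1 := ⟨s - 1, by omega⟩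
    obtain ⟨t, rfl⟩ : ∃ t, r = s + 1 + t := ⟨r - (s + 1), by omega⟩
    subst hs hr
    have A' := A 0 s
    have B' := B (s + 1) t
    simp only [mul_zero, zero_add] at A'
    rw [show 2 * (s + 1) = 2 * s + 1 + 1 by ring, Finset.prod_Ico_succ_top (by omega), A',
      show s + 1 + t + (s + 1 + t) + 1 = 2 * (s + 1) + 2 * t + 1 by ring,
      show 2 * s + 1 + 1 + 1 = 2 * (s + 1) + 1 by ring, B',
      show (2 * s + 1 + 1 - 1) / 2 = s by omega,
      show (s + 1 + t + (s + 1 + t) - (2 * s + 1 + 1)) / 2 = t by omega, ho, he s]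
    ring
  · obtain ⟨t, rfl⟩ : ∃ t, r = s + 1 + t := ⟨r - (s + 1), by omega⟩
    subst hs hr
    have A' := A 0 s
    have B' := B (s + 1) t
    simp only [mul_zero, zero_add] at A'
    rw [A', Finset.prod_eq_prod_Ico_succ_bot (by omega),
      show s + 1 + t + (s + 1 + t) + 1 = 2 * (s + 1) + 2 * t + 1 by ring,
      show 2 * s + 1 + 1 + 1 = 2 * (s + 1) + 1 by ring, B',
      show (2 * s + 1 - 1) / 2 = s by omega,
      show (s + 1 + t + (s + 1 + t) - (2 * s + 1)) / 2 = t by omega, ho, he s]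
    ring

lemma collapse_l (M k : ℕ) (hk : 1 ≤ k) (hkM : k ≤ M) (f : ℕ → ℂ) :
    ∏ l ∈ Finset.Icc 2 M, ∏ m ∈ Finset.Icc 1 (l - 1), (if k = l then f m else 1)
      = ∏ m ∈ Finset.Icc 1 (k - 1), f m := by
  rcases Nat.lt_or_ge k 2 with h | h
  · obtain rfl : k = 1 := by omega
    simp only [Nat.sub_self]
    rw [Finset.Icc_eq_empty (by omega : ¬ 1 ≤ 0), Finset.prod_empty]
    refine Finset.prod_eq_one fun l hl => Finset.prod_eq_one fun m _ => ?_
    rw [Finset.mem_Icc] at hl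
    rw [if_neg (by omega)]
  · rw [Finset.prod_eq_single k]
    · simp
    · intro l _ hl
      exact Finset.prod_eq_one fun m _ => if_neg (Ne.symm hl)
    · intro hn
      exact absurd (Finset.mem_Icc.2 ⟨h, hkM⟩) hn

lemma collapse_m (M k : ℕ) (hk : 1 ≤ k) (g : ℕ → ℂ) :
    ∏ l ∈ Finset.Icc 2 M, ∏ m ∈ Finset.Icc 1 (l - 1), (if k = m then g l else 1)
      = ∏ l ∈ Finset.Icc (k + 1) M, g l := by
  simp only [Finset.prod_ite_eq]
  rw [← Finset.prod_filter]
  refine Finset.prod_congr ?_ fun _ _ => rfl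
  ext l
  simp only [Finset.mem_filter, Finset.mem_Icc]
  omega

/-- reorganisation of the one-cell factors of the combinatorial expansion
of a Bethe vector of the Izergin–Korepin lattice model:
∏_{ℓ=2}^{M} ∏_{m=1}^{ℓ−1} [∏_{a∈A_ℓ}(Z_m + iΔλ_a/2)·∏_{b∈A_m}(Z_ℓ − iΔλ_b/2)]
 = ∏_a α(λ_{σ(a)})^{⌊(n_a−1)/2⌋}·ᾱ(λ_{σ(a)})^{⌊(M−n_a)/2⌋}
   · ∏_a (1 − (−1)^{n_a}·Δ·(c/4 − iλ_{σ(a)}/2)). -/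
theorem bethe_vector_single_cell_factor_identity
    (N M : ℕ) (hN : 1 ≤ N) (hM : 2 ≤ M) (hMeven : Even M)
    (Δ : ℝ) (hΔ : 0 < Δ) (c : ℂ) (lam : Fin N → ℂ)
    (σ : Equiv.Perm (Fin N))
    (n : Fin N → ℕ) (hmono : Monotone n)
    (hlow : ∀ a, 1 ≤ n a) (hup : ∀ a, n a ≤ M) :
    -- here c is complex, so we use the complex version of α with (c : ℂ) replaced by c
    (∏ l ∈ Finset.Icc 2 M, ∏ m ∈ Finset.Icc 1 (l - 1),
        (∏ a ∈ Finset.univ.filter (fun a : Fin N => n (σ⁻¹ a) = l),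
            ((1 + (-1 : ℂ) ^ m * c * (Δ : ℂ) / 4) + Complex.I * (Δ : ℂ) * lam a / 2)) *
          ∏ b ∈ Finset.univ.filter (fun b : Fin N => n (σ⁻¹ b) = m),
            ((1 + (-1 : ℂ) ^ l * c * (Δ : ℂ) / 4) - Complex.I * (Δ : ℂ) * lam b / 2))
      = (∏ a : Fin N,
          ((1 - c * (Δ : ℂ) / 4 + Complex.I * lam (σ a) * (Δ : ℂ) / 2) *
              (1 + c * (Δ : ℂ) / 4 + Complex.I * lam (σ a) * (Δ : ℂ) / 2)) ^ ((n a - 1) / 2) *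
            ((1 - c * (Δ : ℂ) / 4 + Complex.I * (-(lam (σ a))) * (Δ : ℂ) / 2) *
              (1 + c * (Δ : ℂ) / 4 + Complex.I * (-(lam (σ a))) * (Δ : ℂ) / 2)) ^ ((M - n a) / 2)) *
        ∏ a : Fin N,
          (1 - (-1 : ℂ) ^ (n a) * (Δ : ℂ) * (c / 4 - Complex.I * lam (σ a) / 2)) := by
  have swap : ∀ F : ℕ → ℕ → Fin N → ℂ,
      ∏ l ∈ Finset.Icc 2 M, ∏ m ∈ Finset.Icc 1 (l - 1), ∏ a : Fin N, F l m a
        = ∏ a : Fin N, ∏ l ∈ Finset.Icc 2 M, ∏ m ∈ Finset.Icc 1 (l - 1), F l m a := by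
    intro F
    rw [Finset.prod_comm]
    exact Finset.prod_congr rfl fun l _ => Finset.prod_comm
  simp only [Finset.prod_filter, Finset.prod_mul_distrib (s := Finset.Icc _ _)]
  rw [swap, swap, ← Finset.prod_mul_distrib, ← Finset.prod_mul_distrib,
    ← Equiv.prod_comp σ]
  refine Finset.prod_congr rfl fun a _ => ?_
  have hs : σ⁻¹ (σ a) = a := by simp
  simp only [hs]
  rw [collapse_l M (n a) (hlow a) (hup a)
      (fun m => (1 + (-1 : ℂ) ^ m * c * (Δ : ℂ) / 4) + Complex.I * (Δ : ℂ) * lam (σ a) / 2),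
    collapse_m M (n a) (hlow a)
      (fun l => (1 + (-1 : ℂ) ^ l * c * (Δ : ℂ) / 4) - Complex.I * (Δ : ℂ) * lam (σ a) / 2)]
  have key := cell_one M (n a) hMeven (hlow a) (hup a) (c * (Δ : ℂ) / 4)
    (Complex.I * (Δ : ℂ) * lam (σ a) / 2)
  have e1 : ∀ m : ℕ, (-1 : ℂ) ^ m * c * (Δ : ℂ) / 4 = (-1 : ℂ) ^ m * (c * (Δ : ℂ) / 4) :=
    fun m => by ring
  have e2 : Complex.I * lam (σ a) * (Δ : ℂ) / 2 = Complex.I * (Δ : ℂ) * lam (σ a) / 2 := by ring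
  have e3 : ∀ z : ℂ, z + Complex.I * (-(lam (σ a))) * (Δ : ℂ) / 2
      = z - Complex.I * (Δ : ℂ) * lam (σ a) / 2 := fun z => by ring
  have e4 : (-1 : ℂ) ^ (n a) * (Δ : ℂ) * (c / 4 - Complex.I * lam (σ a) / 2)
      = (-1 : ℂ) ^ (n a) * (c * (Δ : ℂ) / 4 - Complex.I * (Δ : ℂ) * lam (σ a) / 2) := by ring
  simp only [e1, e2, e3, e4]
  exact key
end

section
/- Let c > 0, L > 0, N ≥ 1, let λ_1,…,λ_N be pairwise distinct real numbers, and let 0 < y_1 < y_2 < … < y_N < L. For each even integer M set Δ := L/M and n_k(M) := ⌈y_k·M/L⌉ for k = 1,…,N. Then lim_{M→∞, M even} f^{(Δ)}_λ(n_1(M),…,n_N(M)) = c^{−N/2} · i^N · φ(y_1,…,y_N | λ_1,…,λ_N). -/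
open scoped BigOperators
open Filter

/-- α(λ) = (1 − cΔ/4 + iλΔ/2)(1 + cΔ/4 + iλΔ/2). -/
noncomputable def alphaLat (c Δ lam : ℝ) : ℂ :=
  (1 - (c : ℂ) * (Δ : ℂ) / 4 + Complex.I * (lam : ℂ) * (Δ : ℂ) / 2) *
    (1 + (c : ℂ) * (Δ : ℂ) / 4 + Complex.I * (lam : ℂ) * (Δ : ℂ) / 2)

/-- The combinatorial amplitude f^{(Δ)}_λ(n_1,…,n_N) of the lattice Bethe vector. -/
noncomputable def latticeF (c Δ : ℝ) (M N : ℕ) (lam : Fin N → ℝ) (n : Fin N → ℕ) : ℂ :=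
  ∑ σ : Equiv.Perm (Fin N),
    (∏ p ∈ Finset.univ.filter (fun p : Fin N × Fin N => p.1 < p.2),
      ((lam (σ p.1) : ℂ) - (lam (σ p.2) : ℂ)
          + Complex.I * (c : ℂ) * ((Int.sign ((n p.2 : ℤ) - (n p.1 : ℤ)) : ℤ) : ℂ)) /
        ((lam (σ p.1) : ℂ) - (lam (σ p.2) : ℂ))) *
    (∏ a : Fin N,
      alphaLat c Δ (lam (σ a)) ^ ((n a - 1) / 2) *
        alphaLat c Δ (-(lam (σ a))) ^ ((M - n a) / 2)) *
    ∏ a : Fin N,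
      (1 - (-1 : ℂ) ^ (n a) * (Δ : ℂ) * ((c : ℂ) / 4 - Complex.I * (lam (σ a) : ℂ) / 2))

/-- The coordinate Bethe Ansatz wavefunction. -/
noncomputable def betheWave (c L : ℝ) (N : ℕ) (x : Fin N → ℝ) (lam : Fin N → ℂ) : ℂ :=
  (-Complex.I * (Real.sqrt c : ℂ)) ^ N *
    ∑ σ : Equiv.Perm (Fin N),
      (∏ p ∈ Finset.univ.filter (fun p : Fin N × Fin N => p.1 < p.2),
        (lam (σ p.1) - lam (σ p.2)
            - Complex.I * (c : ℂ) * ((Real.sign (x p.1 - x p.2) : ℝ) : ℂ)) /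
          (lam (σ p.1) - lam (σ p.2))) *
      ∏ a : Fin N,
        Complex.exp (Complex.I * lam (σ a) * (x a : ℂ)) *
          Complex.exp (-(Complex.I * lam (σ a) * ((L : ℂ) / 2)))

/-- The exponential limit of powers of `alphaLat`. -/
lemma alphaLat_pow_tendsto (c L lam : ℝ) (k : ℕ → ℕ) (r : ℝ)
    (hk : Tendsto (fun M : ℕ => (k M : ℝ) / (M : ℝ)) atTop (nhds r)) :
    Tendsto (fun M : ℕ => alphaLat c (L / M) lam ^ (k M)) atTop
      (nhds (Complex.exp ((r : ℂ) * (Complex.I * lam * L)))) := by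
  have hinv : Tendsto (fun M : ℕ => ((M : ℂ))⁻¹) atTop (nhds 0) :=
    tendsto_inv_atTop_nhds_zero_nat
  set g : ℕ → ℂ := fun M => alphaLat c (L / M) lam - 1 with hg
  have hform : ∀ M : ℕ, g M = Complex.I * lam * L * (M : ℂ)⁻¹
      - ((lam : ℂ) ^ 2 / 4 + (c : ℂ) ^ 2 / 16) * (L : ℂ) ^ 2 * ((M : ℂ)⁻¹) ^ 2 := by
    intro M
    simp only [hg, alphaLat]
    push_cast
    rw [div_eq_mul_inv (L : ℂ)]
    linear_combination ((lam : ℂ) * L * (M : ℂ)⁻¹) ^ 2 / 4 * Complex.I_sq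
  have hMg : Tendsto (fun M : ℕ => (M : ℂ) * g M) atTop (nhds (Complex.I * lam * L)) := by
    have h1 : Tendsto (fun M : ℕ => Complex.I * lam * L
        - ((lam : ℂ) ^ 2 / 4 + (c : ℂ) ^ 2 / 16) * (L : ℂ) ^ 2 * ((M : ℂ)⁻¹)) atTop
        (nhds (Complex.I * lam * L
        - ((lam : ℂ) ^ 2 / 4 + (c : ℂ) ^ 2 / 16) * (L : ℂ) ^ 2 * 0)) :=
      tendsto_const_nhds.sub (tendsto_const_nhds.mul hinv)
    rw [mul_zero, sub_zero] at h1
    refine h1.congr' ?_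
    filter_upwards [eventually_ne_atTop 0] with M hM
    have hM' : (M : ℂ) ≠ 0 := by exact_mod_cast hM
    rw [hform]
    field_simp
  have hlog := Complex.tendsto_nat_mul_log_one_add_of_tendsto hMg
  have hg0 : Tendsto g atTop (nhds 0) := by
    have h := hMg.mul hinv
    rw [mul_zero] at h
    refine h.congr' ?_
    filter_upwards [eventually_ne_atTop 0] with M hM
    have hM' : (M : ℂ) ≠ 0 := by exact_mod_cast hM
    field_simp
  have hkC : Tendsto (fun M : ℕ => ((((k M : ℝ) / (M : ℝ) : ℝ)) : ℂ)) atTop (nhds (r : ℂ)) :=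
    (Complex.continuous_ofReal.tendsto r).comp hk
  have hfin := (Complex.continuous_exp.tendsto _).comp (hkC.mul hlog)
  refine hfin.congr' ?_
  filter_upwards [eventually_ne_atTop 0, hg0.eventually_ne (show (0 : ℂ) ≠ -1 by simp)] with M hM hne
  have hM' : (M : ℂ) ≠ 0 := by exact_mod_cast hM
  have h1g : 1 + g M ≠ 0 := fun h => hne (by linear_combination h)
  have hal : alphaLat c (L / M) lam = 1 + g M := by simp [hg]
  rw [hal]
  simp only [Function.comp]
  rw [← Complex.exp_log h1g, ← Complex.exp_nat_mul, Complex.exp_log h1g]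
  congr 1
  push_cast
  field_simp

/-- Halving an index up to bounded error halves the density. -/
lemma half_density (k : ℕ → ℕ) (m : ℕ → ℝ) (s : ℝ)
    (hm : Tendsto (fun M : ℕ => m M / (M : ℝ)) atTop (nhds s))
    (hk : ∀ᶠ M in atTop, |2 * (k M : ℝ) - m M| ≤ 3) :
    Tendsto (fun M : ℕ => (k M : ℝ) / (M : ℝ)) atTop (nhds (s / 2)) := by
  have hinv : Tendsto (fun M : ℕ => (3 : ℝ) * ((M : ℝ))⁻¹) atTop (nhds 0) := by
    simpa using (tendsto_inv_atTop_nhds_zero_nat (𝕜 := ℝ)).const_mul 3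
  have h0 : Tendsto (fun M : ℕ => (2 * (k M : ℝ) - m M) / (M : ℝ)) atTop (nhds 0) := by
    refine squeeze_zero_norm' ?_ hinv
    filter_upwards [hk] with M h
    rw [Real.norm_eq_abs, abs_div, Nat.abs_cast, div_eq_mul_inv]
    gcongr
  have h1 := (h0.add hm).div_const 2
  rw [zero_add] at h1
  refine h1.congr fun M => ?_
  ring

lemma ceil_density (L y : ℝ) (hL : 0 < L) (hy : 0 < y) :
    Tendsto (fun M : ℕ => ((⌈y * M / L⌉₊ : ℕ) : ℝ) / (M : ℝ)) atTop (nhds (y / L)) := by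
  have h := (tendsto_nat_ceil_mul_div_atTop (R := ℝ) (a := y / L) (by positivity)).comp
    (tendsto_natCast_atTop_atTop (R := ℝ))
  refine h.congr fun M => ?_
  simp only [Function.comp]
  rw [div_mul_eq_mul_div]

/-- pointwise convergence, as M → ∞ through even integers, of the lattice
amplitude f^{(L/M)}_λ at the sites n_k(M) = ⌈y_k·M/L⌉ to c^{−N/2}·i^N·φ(y_1,…,y_N|λ). -/
theorem latticeF_pointwise_limit
    (c L : ℝ) (hc : 0 < c) (hL : 0 < L) (N : ℕ) (hN : 1 ≤ N)
    (lam : Fin N → ℝ) (hlam : Function.Injective lam)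
    (y : Fin N → ℝ) (hy : StrictMono y)
    (hy0 : ∀ k, 0 < y k) (hyL : ∀ k, y k < L) :
    Tendsto
      (fun M : ℕ =>
        latticeF c (L / M) M N lam (fun k => ⌈y k * M / L⌉₊))
      (atTop ⊓ 𝓟 {M : ℕ | Even M})
      (nhds (((Real.sqrt c : ℂ) ^ N)⁻¹ * Complex.I ^ N *
        betheWave c L N y (fun a => (lam a : ℂ)))) := by
  have hpre : ((Real.sqrt c : ℂ) ^ N)⁻¹ * Complex.I ^ N * (-Complex.I * (Real.sqrt c : ℂ)) ^ N
      = 1 := by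
    have hs : (Real.sqrt c : ℂ) ≠ 0 := by
      exact_mod_cast (Real.sqrt_pos.mpr hc).ne'
    rw [← inv_pow, ← mul_pow, ← mul_pow]
    have : (Real.sqrt c : ℂ)⁻¹ * Complex.I * (-Complex.I * (Real.sqrt c : ℂ)) = 1 := by
      field_simp
      simp
    rw [this, one_pow]
  unfold betheWave
  rw [← mul_assoc, hpre, one_mul]
  refine Tendsto.mono_left ?_ inf_le_left
  unfold latticeF
  have hpos : ∀ k, ∀ᶠ M : ℕ in atTop, 1 ≤ ⌈y k * M / L⌉₊ := by
    intro k
    filter_upwards [eventually_gt_atTop 0] with M hM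
    have hM' : (0 : ℝ) < M := by exact_mod_cast hM
    have := hy0 k
    exact Nat.one_le_iff_ne_zero.mpr (Nat.ceil_pos.mpr (by positivity)).ne'
  have hle : ∀ k, ∀ M : ℕ, ⌈y k * M / L⌉₊ ≤ M := by
    intro k M
    rw [Nat.ceil_le, div_le_iff₀ hL, mul_comm]
    exact mul_le_mul_of_nonneg_left (hyL k).le (Nat.cast_nonneg M)
  have hd := fun k => ceil_density L (y k) hL (hy0 k)
  refine tendsto_finsetSum _ fun σ _ => ?_
  have hA : Tendsto (fun M : ℕ => ∏ p ∈ Finset.univ.filter (fun p : Fin N × Fin N => p.1 < p.2),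
      ((lam (σ p.1) : ℂ) - (lam (σ p.2) : ℂ)
          + Complex.I * (c : ℂ) *
            ((Int.sign ((⌈y p.2 * M / L⌉₊ : ℤ) - (⌈y p.1 * M / L⌉₊ : ℤ)) : ℤ) : ℂ)) /
        ((lam (σ p.1) : ℂ) - (lam (σ p.2) : ℂ))) atTop
      (nhds (∏ p ∈ Finset.univ.filter (fun p : Fin N × Fin N => p.1 < p.2),
        ((lam (σ p.1) : ℂ) - (lam (σ p.2) : ℂ)
            - Complex.I * (c : ℂ) * ((Real.sign (y p.1 - y p.2) : ℝ) : ℂ)) /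
          ((lam (σ p.1) : ℂ) - (lam (σ p.2) : ℂ)))) := by
    refine tendsto_finsetProd _ fun p hp => ?_
    have hlt : y p.1 < y p.2 := hy (Finset.mem_filter.mp hp).2
    apply tendsto_nhds_of_eventually_eq
    have hlt' : y p.1 / L < y p.2 / L := by gcongr
    filter_upwards [(hd p.1).eventually_lt (hd p.2) hlt', eventually_gt_atTop 0] with M hM hM0
    have hM' : (0 : ℝ) < M := by exact_mod_cast hM0
    have h1 : ⌈y p.1 * M / L⌉₊ < ⌈y p.2 * M / L⌉₊ := by
      exact_mod_cast (div_lt_div_iff_of_pos_right hM').mp hM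
    rw [Int.sign_eq_one_of_pos (by omega), Real.sign_of_neg (by linarith)]
    push_cast
    ring
  have hB : Tendsto (fun M : ℕ => ∏ a : Fin N,
      alphaLat c (L / M) (lam (σ a)) ^ ((⌈y a * M / L⌉₊ - 1) / 2) *
        alphaLat c (L / M) (-(lam (σ a))) ^ ((M - ⌈y a * M / L⌉₊) / 2)) atTop
      (nhds (∏ a : Fin N, Complex.exp (Complex.I * (lam (σ a) : ℂ) * (y a : ℂ)) *
          Complex.exp (-(Complex.I * (lam (σ a) : ℂ) * ((L : ℂ) / 2))))) := by
    refine tendsto_finsetProd _ fun a _ => ?_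
    have hk1 := half_density (fun M => (⌈y a * M / L⌉₊ - 1) / 2) _ _ (hd a) (by
      filter_upwards [hpos a] with M hM
      have h1 : 2 * ((⌈y a * M / L⌉₊ - 1) / 2) ≤ ⌈y a * M / L⌉₊ + 3 := by omega
      have h2 : ⌈y a * M / L⌉₊ ≤ 2 * ((⌈y a * M / L⌉₊ - 1) / 2) + 3 := by omega
      have h1' : 2 * (((⌈y a * M / L⌉₊ - 1) / 2 : ℕ) : ℝ) ≤ (⌈y a * M / L⌉₊ : ℝ) + 3 := by
        exact_mod_cast h1
      have h2' : (⌈y a * M / L⌉₊ : ℝ) ≤ 2 * (((⌈y a * M / L⌉₊ - 1) / 2 : ℕ) : ℝ) + 3 := by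
        exact_mod_cast h2
      rw [abs_le]
      constructor <;> linarith)
    have hd2 : Tendsto (fun M : ℕ => ((M : ℝ) - (⌈y a * M / L⌉₊ : ℝ)) / (M : ℝ)) atTop
        (nhds (1 - y a / L)) := by
      refine ((hd a).const_sub 1).congr' ?_
      filter_upwards [eventually_ne_atTop 0] with M hM
      have hM' : (M : ℝ) ≠ 0 := by exact_mod_cast hM
      rw [sub_div, div_self hM']
    have hk2 := half_density (fun M => (M - ⌈y a * M / L⌉₊) / 2) _ _ hd2 (by
      refine Eventually.of_forall fun M => ?_
      have h0 := hle a M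
      have h1 : 2 * ((M - ⌈y a * M / L⌉₊) / 2) + ⌈y a * M / L⌉₊ ≤ M + 3 := by omega
      have h2 : M ≤ 2 * ((M - ⌈y a * M / L⌉₊) / 2) + ⌈y a * M / L⌉₊ + 3 := by omega
      have h1' : 2 * (((M - ⌈y a * M / L⌉₊) / 2 : ℕ) : ℝ) + (⌈y a * M / L⌉₊ : ℝ) ≤ M + 3 := by
        exact_mod_cast h1
      have h2' : (M : ℝ) ≤ 2 * (((M - ⌈y a * M / L⌉₊) / 2 : ℕ) : ℝ) + (⌈y a * M / L⌉₊ : ℝ) + 3 := by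
        exact_mod_cast h2
      rw [abs_le]
      constructor <;> linarith)
    have h := (alphaLat_pow_tendsto c L (lam (σ a)) _ _ hk1).mul
      (alphaLat_pow_tendsto c L (-(lam (σ a))) _ _ hk2)
    convert h using 2
    rw [← Complex.exp_add, ← Complex.exp_add]
    congr 1
    have hL' : (L : ℂ) ≠ 0 := by exact_mod_cast hL.ne'
    push_cast
    field_simp
    ring
  have hC : Tendsto (fun M : ℕ => ∏ a : Fin N,
      (1 - (-1 : ℂ) ^ (⌈y a * M / L⌉₊) * ((L / M : ℝ) : ℂ) *
        ((c : ℂ) / 4 - Complex.I * (lam (σ a) : ℂ) / 2))) atTop (nhds (∏ a : Fin N, (1 : ℂ))) := by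
    refine tendsto_finsetProd _ fun a _ => ?_
    have hΔ : Tendsto (fun M : ℕ => ((L / M : ℝ) : ℂ)) atTop (nhds 0) := by
      have h := (Complex.continuous_ofReal.tendsto 0).comp
        (tendsto_const_div_atTop_nhds_zero_nat L)
      simpa [Function.comp_def] using h
    have hs : Tendsto (fun M : ℕ => (-1 : ℂ) ^ (⌈y a * M / L⌉₊) * ((L / M : ℝ) : ℂ)) atTop
        (nhds 0) := by
      rw [tendsto_zero_iff_norm_tendsto_zero] at hΔ ⊢
      refine hΔ.congr fun M => ?_
      rw [norm_mul, norm_pow, norm_neg, norm_one, one_pow, one_mul]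
    have h := (hs.mul_const ((c : ℂ) / 4 - Complex.I * (lam (σ a) : ℂ) / 2)).const_sub 1
    simpa only [zero_mul, sub_zero] using h
  have h := (hA.mul hB).mul hC
  rw [Finset.prod_const_one, mul_one] at h
  exact h
end

section
/- Let c > 0, L > 0, N ≥ 1, and let λ_1,…,λ_N and μ_1,…,μ_N be two families of pairwise distinct real numbers. Then lim_{M→∞, M even} (L/M)^N · Σ_{1 ≤ n_1 < n_2 < … < n_N ≤ M} conj(f^{(L/M)}_μ(n_1,…,n_N)) · f^{(L/M)}_λ(n_1,…,n_N) = c^{−N} · ∫_{0 ≤ y_1 < y_2 < … < y_N ≤ L} conj(φ(y_1,…,y_N | μ_1,…,μ_N))·φ(y_1,…,y_N | λ_1,…,λ_N) d^N y, where conj denotes complex conjugation. -/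
open scoped BigOperators Classical
open MeasureTheory Filter

theorem pow_tendsto_exp (w : ℕ → ℂ) (k : ℕ → ℕ) (z : ℂ) (hw : Tendsto w atTop (nhds 0))
    (hk : Tendsto (fun M => (k M : ℂ) * w M) atTop (nhds z)) :
    Tendsto (fun M => (1 + w M) ^ k M) atTop (nhds (Complex.exp z)) := by
  have hw' : ∀ᶠ M in atTop, ‖w M‖ < 1/2 := by
    have := hw.norm
    rw [norm_zero] at this
    exact this.eventually (gt_mem_nhds (by norm_num))
  have h1 : Tendsto (fun M => (k M : ℂ) * (Complex.log (1 + w M) - w M)) atTop (nhds 0) := by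
    have h2 : Tendsto (fun M => ‖(k M : ℂ) * w M‖ * ‖w M‖) atTop (nhds 0) := by
      have := hk.norm.mul hw.norm
      simpa using this
    refine squeeze_zero_norm' ?_ h2
    filter_upwards [hw'] with M hM
    have h3 := Complex.norm_log_one_add_sub_self_le (z := w M) (by linarith)
    have h4 : (1 - ‖w M‖)⁻¹ ≤ 2 := by
      rw [inv_le_comm₀ (by linarith) (by norm_num)]
      linarith
    have h5 : ‖Complex.log (1 + w M) - w M‖ ≤ ‖w M‖ ^ 2 := by
      nlinarith [sq_nonneg ‖w M‖]
    rw [norm_mul, norm_mul]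
    nlinarith [norm_nonneg (k M : ℂ)]
  have h6 : Tendsto (fun M => (k M : ℂ) * Complex.log (1 + w M)) atTop (nhds z) := by
    have := h1.add hk
    simp only [zero_add] at this
    refine this.congr fun M => by ring
  have h7 := (Complex.continuous_exp.tendsto z).comp h6
  refine h7.congr' ?_
  filter_upwards [hw'] with M hM
  have : 1 + w M ≠ 0 := by
    intro h
    have : w M = -1 := by linear_combination h
    rw [this] at hM
    norm_num at hM
  simp only [Function.comp]
  rw [Complex.exp_nat_mul, Complex.exp_log this]

/-- the rounding map from the continuum to lattice sites -/
noncomputable def nuSite (L : ℝ) (M : ℕ) (y : ℝ) : ℕ := ⌈y * M / L⌉₊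

/-- cells of the lattice -/
def latCell (L : ℝ) (M N : ℕ) (n : Fin N → ℕ) : Set (Fin N → ℝ) :=
  Set.pi Set.univ fun i => Set.Ioc (((n i : ℝ) - 1) * (L / M)) ((n i : ℝ) * (L / M))

theorem mem_cell_iff (L : ℝ) (hL : 0 < L) (M N : ℕ) (hM : 0 < M) (n : Fin N → ℕ)
    (hn : ∀ i, 1 ≤ n i) (y : Fin N → ℝ) :
    y ∈ latCell L M N n ↔ (fun i => nuSite L M (y i)) = n := by
  have hM' : (0 : ℝ) < M := by exact_mod_cast hM
  simp only [latCell, Set.mem_pi, Set.mem_univ, true_implies, funext_iff, nuSite, Set.mem_Ioc]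
  refine forall_congr' fun i => ?_
  have h1 := hn i
  rw [Nat.ceil_eq_iff (by omega)]
  rw [Nat.cast_sub h1, Nat.cast_one, lt_div_iff₀ hL, div_le_iff₀ hL, ← mul_div_assoc,
    ← mul_div_assoc, div_lt_iff₀ hM', le_div_iff₀ hM']

theorem cell_meas (L : ℝ) (M N : ℕ) (n : Fin N → ℕ) : MeasurableSet (latCell L M N n) :=
  MeasurableSet.univ_pi fun _ => measurableSet_Ioc

theorem cell_vol (L : ℝ) (hL : 0 < L) (M N : ℕ) (n : Fin N → ℕ) :
    volume (latCell L M N n) = ENNReal.ofReal (L / M) ^ N := by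
  rw [latCell, Real.volume_pi_Ioc]
  have : ∀ i, (n i : ℝ) * (L / M) - ((n i : ℝ) - 1) * (L / M) = L / M := fun i => by ring
  simp [this]

theorem sum_eq_integral (L : ℝ) (hL : 0 < L) (M N : ℕ) (S : Finset (Fin N → ℕ))
    (F : (Fin N → ℕ) → ℂ) :
    ((L / M : ℝ) : ℂ) ^ N * ∑ n ∈ S, F n =
      ∫ y, ∑ n ∈ S, (latCell L M N n).indicator (fun _ => F n) y := by
  rw [integral_finset_sum]
  · rw [Finset.mul_sum]
    refine Finset.sum_congr rfl fun n _ => ?_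
    rw [integral_indicator_const _ (cell_meas L M N n), Measure.real, cell_vol L hL,
      ENNReal.toReal_pow, ENNReal.toReal_ofReal (by positivity), Complex.real_smul,
      Complex.ofReal_pow]
  · intro n _
    refine (integrable_indicator_iff (cell_meas L M N n)).2 (integrableOn_const ?_)
    rw [cell_vol L hL]
    exact ENNReal.pow_ne_top ENNReal.ofReal_ne_top

theorem sum_ind_eq (L : ℝ) (hL : 0 < L) (M N : ℕ) (hM : 0 < M) (S : Finset (Fin N → ℕ))
    (hS : ∀ n ∈ S, ∀ i, 1 ≤ n i) (F : (Fin N → ℕ) → ℂ) (y : Fin N → ℝ) :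
    ∑ n ∈ S, (latCell L M N n).indicator (fun _ => F n) y =
      if (fun i => nuSite L M (y i)) ∈ S then F (fun i => nuSite L M (y i)) else 0 := by
  rw [← Finset.sum_ite_eq S (fun i => nuSite L M (y i)) F]
  refine Finset.sum_congr rfl fun n hn => ?_
  rw [Set.indicator_apply]
  exact if_congr (mem_cell_iff L hL M N hM n (hS n hn) y) rfl rfl

theorem tendsto_kL (L y : ℝ) (hL : 0 < L) (k : ℕ → ℕ) (C : ℝ)
    (hk : ∀ᶠ M : ℕ in atTop, |2 * (k M : ℝ) - y * M / L| ≤ C) :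
    Tendsto (fun M : ℕ => (k M : ℝ) * (L / M)) atTop (nhds (y / 2)) := by
  have h0 : Tendsto (fun M : ℕ => C * (L / (M : ℝ)) / 2) atTop (nhds 0) := by
    have := ((tendsto_const_div_atTop_nhds_zero_nat L).const_mul C).div_const 2
    simpa using this
  rw [tendsto_iff_dist_tendsto_zero]
  refine squeeze_zero' (Eventually.of_forall fun _ => dist_nonneg) ?_ h0
  filter_upwards [hk, eventually_gt_atTop 0] with M h hM
  have hM' : (0 : ℝ) < M := by exact_mod_cast hM
  rw [Real.dist_eq]
  have : (k M : ℝ) * (L / M) - y / 2 = (2 * (k M : ℝ) - y * M / L) * (L / M) / 2 := by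
    field_simp
  rw [this, abs_div, abs_mul, abs_of_pos (div_pos hL hM'), abs_two]
  gcongr

theorem alpha_eq (c Δ l : ℝ) : alphaLat c Δ l =
    1 + (Δ : ℂ) * (Complex.I * l + (Δ : ℂ) * (-((c : ℂ) ^ 2 / 16) - (l : ℂ) ^ 2 / 4)) := by
  unfold alphaLat
  linear_combination (l : ℂ) ^ 2 * (Δ : ℂ) ^ 2 / 4 * Complex.I_sq

theorem alpha_pow_tendsto (c L l y : ℝ) (hL : 0 < L) (k : ℕ → ℕ) (C : ℝ)
    (hk : ∀ᶠ M : ℕ in atTop, |2 * (k M : ℝ) - y * M / L| ≤ C) :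
    Tendsto (fun M : ℕ => alphaLat c (L / M) l ^ k M) atTop
      (nhds (Complex.exp ((y : ℂ) / 2 * (Complex.I * l)))) := by
  simp only [alpha_eq]
  have h1 : Tendsto (fun M : ℕ => ((L / M : ℝ) : ℂ)) atTop (nhds 0) := by
    have := (Complex.continuous_ofReal.tendsto 0).comp (tendsto_const_div_atTop_nhds_zero_nat L)
    simpa [Function.comp_def] using this
  have h2 : Tendsto (fun M : ℕ => (Complex.I * l + ((L / M : ℝ) : ℂ) *
      (-((c : ℂ) ^ 2 / 16) - (l : ℂ) ^ 2 / 4))) atTop (nhds (Complex.I * l)) := by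
    have := (h1.mul_const (-((c : ℂ) ^ 2 / 16) - (l : ℂ) ^ 2 / 4)).const_add (Complex.I * l)
    simpa using this
  apply pow_tendsto_exp
  · simpa using h1.mul h2
  · have h3 := (Complex.continuous_ofReal.tendsto _).comp (tendsto_kL L y hL k C hk)
    have h4 := h3.mul h2
    simp only [Function.comp, Complex.ofReal_mul, Complex.ofReal_natCast] at h4
    rw [Complex.ofReal_div, Complex.ofReal_ofNat] at h4
    refine h4.congr fun M => by ring

/-- one-particle factor -/
noncomputable def sFac (c L : ℝ) (M : ℕ) (l : ℝ) (n : ℕ) : ℂ :=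
  alphaLat c (L / M) l ^ ((n - 1) / 2) * alphaLat c (L / M) (-l) ^ ((M - n) / 2) *
    (1 - (-1 : ℂ) ^ n * ((L / M : ℝ) : ℂ) * ((c : ℂ) / 4 - Complex.I * (l : ℂ) / 2))

/-- limit of the one-particle factor -/
noncomputable def eFac (L l y : ℝ) : ℂ :=
  Complex.exp (Complex.I * l * y) * Complex.exp (-(Complex.I * l * ((L : ℂ) / 2)))

theorem nu_range (L : ℝ) (hL : 0 < L) (M : ℕ) (hM : 0 < M) (y : ℝ) :
    (nuSite L M y ∈ Finset.Icc 1 M) ↔ y ∈ Set.Ioc 0 L := by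
  have hM' : (0 : ℝ) < M := by exact_mod_cast hM
  rw [Finset.mem_Icc, nuSite, Nat.ceil_le, Nat.one_le_ceil_iff, Set.mem_Ioc, div_le_iff₀ hL,
    lt_div_iff₀ hL, zero_mul, mul_comm y, mul_le_mul_iff_right₀ hM', mul_pos_iff_of_pos_left hM']

theorem sFac_tendsto (c L l y : ℝ) (hL : 0 < L) (hy : y ∈ Set.Ioc 0 L) :
    Tendsto (fun M : ℕ => sFac c L M l (nuSite L M y)) atTop (nhds (eFac L l y)) := by
  have hb : ∀ᶠ M : ℕ in atTop, 1 ≤ nuSite L M y ∧ nuSite L M y ≤ M ∧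
      y * M / L ≤ nuSite L M y ∧ (nuSite L M y : ℝ) < y * M / L + 1 := by
    filter_upwards [eventually_gt_atTop 0] with M hM
    have := (nu_range L hL M hM y).2 hy
    rw [Finset.mem_Icc] at this
    refine ⟨this.1, this.2, Nat.le_ceil _, Nat.ceil_lt_add_one ?_⟩
    have := hy.1
    positivity
  have h1 := alpha_pow_tendsto c L l y hL (fun M => (nuSite L M y - 1) / 2) 4 (by
    filter_upwards [hb] with M ⟨h1, h2, h3, h4⟩
    have a1 : nuSite L M y ≤ 2 * ((nuSite L M y - 1) / 2) + 2 := by omega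
    have a2 : 2 * ((nuSite L M y - 1) / 2) ≤ nuSite L M y := by omega
    have a1' : (nuSite L M y : ℝ) ≤ 2 * (((nuSite L M y - 1) / 2 : ℕ) : ℝ) + 2 := by
      exact_mod_cast a1
    have a2' : 2 * (((nuSite L M y - 1) / 2 : ℕ) : ℝ) ≤ (nuSite L M y : ℝ) := by
      exact_mod_cast a2
    rw [abs_le]
    constructor <;> linarith)
  have h2 := alpha_pow_tendsto c L (-l) (L - y) hL (fun M => (M - nuSite L M y) / 2) 4 (by
    filter_upwards [hb] with M ⟨h1, h2, h3, h4⟩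
    have a1 : M ≤ 2 * ((M - nuSite L M y) / 2) + 1 + nuSite L M y := by omega
    have a2 : 2 * ((M - nuSite L M y) / 2) + nuSite L M y ≤ M := by omega
    have a1' : (M : ℝ) ≤ 2 * (((M - nuSite L M y) / 2 : ℕ) : ℝ) + 1 + nuSite L M y := by
      exact_mod_cast a1
    have a2' : 2 * (((M - nuSite L M y) / 2 : ℕ) : ℝ) + nuSite L M y ≤ (M : ℝ) := by
      exact_mod_cast a2
    have e : (L - y) * M / L = M - y * M / L := by field_simp
    rw [e, abs_le]
    constructor <;> linarith)
  have h3 : Tendsto (fun M : ℕ => 1 - (-1 : ℂ) ^ nuSite L M y * ((L / M : ℝ) : ℂ) *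
      ((c : ℂ) / 4 - Complex.I * (l : ℂ) / 2)) atTop (nhds 1) := by
    have : Tendsto (fun M : ℕ => (-1 : ℂ) ^ nuSite L M y * ((L / M : ℝ) : ℂ) *
      ((c : ℂ) / 4 - Complex.I * (l : ℂ) / 2)) atTop (nhds 0) := by
      have h5 := ((tendsto_const_div_atTop_nhds_zero_nat L).norm).mul_const
        ‖((c : ℂ) / 4 - Complex.I * (l : ℂ) / 2)‖
      rw [norm_zero, zero_mul] at h5
      refine squeeze_zero_norm (fun M => le_of_eq ?_) h5
      rw [norm_mul, norm_mul, norm_pow, norm_neg, norm_one, one_pow, one_mul, Complex.norm_real]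
    simpa using this.const_sub 1
  have h4 := (h1.mul h2).mul h3
  unfold sFac
  convert h4 using 2
  rw [eFac, ← Complex.exp_add, mul_one, ← Complex.exp_add]
  congr 1
  push_cast
  ring

theorem alpha_pow_bound (c L l : ℝ) (hL : 0 < L) : ∃ C : ℝ, 0 ≤ C ∧ ∀ M : ℕ, 0 < M → ∀ k ≤ M,
    ‖alphaLat c (L / M) l ^ k‖ ≤ C := by
  refine ⟨Real.exp (L * (|l| + L * ‖(-((c : ℂ) ^ 2 / 16) - (l : ℂ) ^ 2 / 4)‖)),
    (Real.exp_pos _).le, fun M hM k hk => ?_⟩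
  have hM' : (1 : ℝ) ≤ M := by exact_mod_cast hM
  have hk' : (k : ℝ) ≤ M := by exact_mod_cast hk
  set K := ‖(-((c : ℂ) ^ 2 / 16) - (l : ℂ) ^ 2 / 4)‖ with hK
  have hK0 : 0 ≤ K := norm_nonneg _
  have hD : L / M ≤ L := div_le_self hL.le hM'
  have hD0 : 0 < L / M := by positivity
  have h1 : ‖alphaLat c (L / M) l‖ ≤ Real.exp (L / M * (|l| + L * K)) := by
    rw [alpha_eq]
    calc _ ≤ ‖(1 : ℂ)‖ + ‖((L / M : ℝ) : ℂ)‖ * (‖Complex.I * l‖ + ‖((L / M : ℝ) : ℂ)‖ * K) := by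
          refine (norm_add_le _ _).trans ?_
          rw [norm_mul]
          gcongr
          refine (norm_add_le _ _).trans ?_
          rw [norm_mul (((L / M : ℝ) : ℂ))]
      _ ≤ L / M * (|l| + L * K) + 1 := by
          rw [Complex.norm_real, norm_mul, Complex.norm_I, Complex.norm_real, norm_one,
            Real.norm_eq_abs, Real.norm_eq_abs, abs_of_pos hD0, one_mul, add_comm]
          gcongr
      _ ≤ _ := Real.add_one_le_exp _
  rw [norm_pow]
  calc _ ≤ Real.exp (L / M * (|l| + L * K)) ^ k := by gcongr
    _ = Real.exp (k * (L / M * (|l| + L * K))) := by rw [← Real.exp_nat_mul]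
    _ ≤ Real.exp (M * (L / M * (|l| + L * K))) := by gcongr
    _ = _ := by
      congr 1
      field_simp

theorem sFac_bound (c L l : ℝ) (hL : 0 < L) : ∃ C : ℝ, 0 ≤ C ∧ ∀ M : ℕ, 0 < M → ∀ n ≤ M,
    ‖sFac c L M l n‖ ≤ C := by
  obtain ⟨C1, h10, h1⟩ := alpha_pow_bound c L l hL
  obtain ⟨C2, h20, h2⟩ := alpha_pow_bound c L (-l) hL
  refine ⟨C1 * C2 * (1 + L * ‖((c : ℂ) / 4 - Complex.I * (l : ℂ) / 2)‖), by positivity,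
    fun M hM n hn => ?_⟩
  have hM' : (1 : ℝ) ≤ M := by exact_mod_cast hM
  have hD : L / M ≤ L := div_le_self hL.le hM'
  have hD0 : 0 < L / M := by positivity
  rw [sFac, norm_mul, norm_mul]
  gcongr
  · exact h1 M hM _ (by omega)
  · exact h2 M hM _ (by omega)
  · refine (norm_sub_le _ _).trans ?_
    rw [norm_mul, norm_mul, norm_pow, norm_neg, norm_one, one_pow, one_mul, Complex.norm_real,
      Real.norm_eq_abs, abs_of_pos hD0]
    gcongr

/-- two-particle factor in the ordered sector -/
noncomputable def aFac (c : ℝ) (N : ℕ) (lam : Fin N → ℝ) (σ : Equiv.Perm (Fin N)) : ℂ :=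
  ∏ p ∈ Finset.univ.filter (fun p : Fin N × Fin N => p.1 < p.2),
      ((lam (σ p.1) : ℂ) - (lam (σ p.2) : ℂ) + Complex.I * (c : ℂ)) /
        ((lam (σ p.1) : ℂ) - (lam (σ p.2) : ℂ))

theorem latticeF_eq (c L : ℝ) (M N : ℕ) (lam : Fin N → ℝ) (n : Fin N → ℕ) (hn : StrictMono n) :
    latticeF c (L / M) M N lam n =
      ∑ σ : Equiv.Perm (Fin N), aFac c N lam σ * ∏ a, sFac c L M (lam (σ a)) (n a) := by
  unfold latticeF
  refine Finset.sum_congr rfl fun σ _ => ?_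
  rw [mul_assoc, ← Finset.prod_mul_distrib]
  congr 1
  refine Finset.prod_congr rfl fun p hp => ?_
  have h := hn (Finset.mem_filter.1 hp).2
  rw [Int.sign_eq_one_of_pos (by omega)]
  simp

theorem betheWave_eq (c L : ℝ) (N : ℕ) (lam : Fin N → ℝ) (y : Fin N → ℝ) (hy : StrictMono y) :
    betheWave c L N y (fun a => (lam a : ℂ)) = (-Complex.I * (Real.sqrt c : ℂ)) ^ N *
      ∑ σ : Equiv.Perm (Fin N), aFac c N lam σ * ∏ a, eFac L (lam (σ a)) (y a) := by
  unfold betheWave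
  congr 1
  refine Finset.sum_congr rfl fun σ _ => ?_
  congr 1
  refine Finset.prod_congr rfl fun p hp => ?_
  have h := hy (Finset.mem_filter.1 hp).2
  rw [Real.sign_of_neg (by linarith)]
  simp

theorem latticeF_bound (c L : ℝ) (hL : 0 < L) (N : ℕ) (lam : Fin N → ℝ) :
    ∃ C : ℝ, 0 ≤ C ∧ ∀ M : ℕ, 0 < M → ∀ n : Fin N → ℕ, StrictMono n → (∀ i, n i ≤ M) →
      ‖latticeF c (L / M) M N lam n‖ ≤ C := by
  choose C hC0 hC using fun l => sFac_bound c L l hL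
  refine ⟨∑ σ : Equiv.Perm (Fin N), ‖aFac c N lam σ‖ * ∏ a, C (lam (σ a)),
    Finset.sum_nonneg fun σ _ => mul_nonneg (norm_nonneg _) (Finset.prod_nonneg fun a _ => hC0 _),
    fun M hM n hn hnM => ?_⟩
  rw [latticeF_eq c L M N lam n hn]
  refine (norm_sum_le _ _).trans (Finset.sum_le_sum fun σ _ => ?_)
  rw [norm_mul, norm_prod]
  gcongr with a _
  exact hC _ M hM _ (hnM a)

theorem nu_lt (L : ℝ) (hL : 0 < L) (x y : ℝ) (hx : 0 < x) (hxy : x < y) :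
    ∀ᶠ M : ℕ in atTop, nuSite L M x < nuSite L M y := by
  have h := (tendsto_natCast_atTop_atTop (R := ℝ)).eventually_ge_atTop (L / (y - x))
  filter_upwards [h] with M hM
  have h0 : 0 < y - x := by linarith
  rw [div_le_iff₀ h0] at hM
  have h1 : (nuSite L M x : ℝ) < x * M / L + 1 := Nat.ceil_lt_add_one (by positivity)
  have h2 : y * M / L ≤ nuSite L M y := Nat.le_ceil _
  have h3 : x * M / L + 1 ≤ y * M / L := by
    rw [div_add_one hL.ne', div_le_div_iff_of_pos_right hL]
    linarith
  exact_mod_cast h1.trans_le (h3.trans h2)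

theorem nu_lt_imp (L : ℝ) (hL : 0 < L) (M : ℕ) (x y : ℝ) (h : nuSite L M x < nuSite L M y) :
    x < y := by
  by_contra! hc
  refine absurd h (not_lt.2 (Nat.ceil_mono ?_))
  gcongr

/-- convergence, as M → ∞ through even integers, of the off-diagonal
lattice scalar-product sums to the scalar product of coordinate Bethe wavefunctions over
the ordered simplex {0 ≤ y_1 < … < y_N ≤ L}. -/
theorem lattice_scalar_product_converges
    (c L : ℝ) (hc : 0 < c) (hL : 0 < L) (N : ℕ) (hN : 1 ≤ N)
    (lam mu : Fin N → ℝ)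
    (hlam : Function.Injective lam) (hmu : Function.Injective mu) :
    Tendsto
      (fun M : ℕ =>
        ((L / M : ℝ) : ℂ) ^ N *
          ∑ n ∈ (Fintype.piFinset fun _ : Fin N => Finset.Icc 1 M).filter
              (fun n : Fin N → ℕ => StrictMono n),
            (starRingEnd ℂ) (latticeF c (L / M) M N mu n) * latticeF c (L / M) M N lam n)
      (atTop ⊓ 𝓟 {M : ℕ | Even M})
      (nhds (((c : ℂ) ^ N)⁻¹ *
        ∫ y in {y : Fin N → ℝ | StrictMono y ∧ ∀ i, y i ∈ Set.Icc (0 : ℝ) L},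
          (starRingEnd ℂ) (betheWave c L N y (fun a => (mu a : ℂ))) *
            betheWave c L N y (fun a => (lam a : ℂ)))) := by
  refine Tendsto.mono_left ?_ inf_le_left
  have hSm : MeasurableSet {y : Fin N → ℝ | StrictMono y ∧ ∀ i, y i ∈ Set.Icc (0 : ℝ) L} := by
    have : {y : Fin N → ℝ | StrictMono y ∧ ∀ i, y i ∈ Set.Icc (0 : ℝ) L} =
        (⋂ i, ⋂ j, ⋂ (_ : i < j), {y : Fin N → ℝ | y i < y j}) ∩
          Set.pi Set.univ fun _ => Set.Icc (0 : ℝ) L := by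
      ext y
      simp only [StrictMono, Set.mem_setOf_eq, Set.mem_inter_iff, Set.mem_iInter, Set.mem_pi,
        Set.mem_univ, true_implies]
    rw [this]
    refine MeasurableSet.inter ?_ (MeasurableSet.univ_pi fun _ => measurableSet_Icc)
    refine MeasurableSet.iInter fun i => MeasurableSet.iInter fun j => MeasurableSet.iInter fun _ =>
      measurableSet_lt (measurable_pi_apply i) (measurable_pi_apply j)
  rw [← integral_indicator hSm, ← integral_const_mul]
  simp only [sum_eq_integral L hL]
  obtain ⟨C1, h10, h1⟩ := latticeF_bound c L hL N mu
  obtain ⟨C2, h20, h2⟩ := latticeF_bound c L hL N lam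
  have key : ∀ M : ℕ, 0 < M → ∀ (F : (Fin N → ℕ) → ℂ) (y : Fin N → ℝ),
      ∑ n ∈ (Fintype.piFinset fun _ : Fin N => Finset.Icc 1 M).filter
              (fun n : Fin N → ℕ => StrictMono n), (latCell L M N n).indicator (fun _ => F n) y =
      if (∀ i, y i ∈ Set.Ioc 0 L) ∧ StrictMono (fun i => nuSite L M (y i))
        then F (fun i => nuSite L M (y i)) else 0 := by
    intro M hM F y
    rw [sum_ind_eq L hL M N hM]
    · refine if_congr ?_ rfl rfl
      simp only [Finset.mem_filter, Fintype.mem_piFinset, nu_range L hL M hM]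
    · intro n hn i
      have := Fintype.mem_piFinset.1 (Finset.mem_filter.1 hn).1 i
      exact (Finset.mem_Icc.1 this).1
  refine tendsto_integral_filter_of_dominated_convergence
    ((Set.pi Set.univ fun _ : Fin N => Set.Icc (0 : ℝ) L).indicator fun _ => C1 * C2) ?_ ?_ ?_ ?_
  · refine Eventually.of_forall fun M => Measurable.aestronglyMeasurable ?_
    exact Finset.measurable_sum _ fun n _ => measurable_const.indicator (cell_meas L M N n)
  · filter_upwards [eventually_gt_atTop 0] with M hM
    refine Eventually.of_forall fun y => ?_
    rw [key M hM]
    split_ifs with h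
    · rw [Set.indicator_of_mem (by
        simp only [Set.mem_pi, Set.mem_univ, true_implies]
        exact fun i => Set.Ioc_subset_Icc_self (h.1 i)), norm_mul, RCLike.norm_conj]
      have hle : ∀ i, nuSite L M (y i) ≤ M := fun i =>
        (Finset.mem_Icc.1 ((nu_range L hL M hM (y i)).2 (h.1 i))).2
      exact mul_le_mul (h1 M hM _ h.2 hle) (h2 M hM _ h.2 hle) (norm_nonneg _) h10
    · rw [norm_zero]
      exact Set.indicator_nonneg (fun _ _ => mul_nonneg h10 h20) _
  · refine (integrable_indicator_iff (MeasurableSet.univ_pi fun _ => measurableSet_Icc)).2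
      (integrableOn_const ?_)
    exact (isCompact_univ_pi fun _ => isCompact_Icc).measure_lt_top.ne
  · have hz : ∀ᵐ y : Fin N → ℝ, ∀ i, y i ≠ 0 := by
      rw [ae_all_iff]
      intro i
      rw [ae_iff]
      simp only [not_not]
      exact Measure.pi_hyperplane (fun _ => volume) i 0
    filter_upwards [hz] with y hy
    have hlim : Tendsto (fun M : ℕ => if (∀ i, y i ∈ Set.Ioc 0 L) ∧
        StrictMono (fun i => nuSite L M (y i)) then
          (starRingEnd ℂ) (latticeF c (L / M) M N mu fun i => nuSite L M (y i)) *
            latticeF c (L / M) M N lam (fun i => nuSite L M (y i)) else 0) atTop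
        (nhds (((c : ℂ) ^ N)⁻¹ *
          {y : Fin N → ℝ | StrictMono y ∧ ∀ i, y i ∈ Set.Icc (0 : ℝ) L}.indicator
            (fun y => (starRingEnd ℂ) (betheWave c L N y (fun a => (mu a : ℂ))) *
            betheWave c L N y (fun a => (lam a : ℂ))) y)) := by
      by_cases h : StrictMono y ∧ ∀ i, y i ∈ Set.Icc (0 : ℝ) L
      · rw [Set.indicator_of_mem (by exact h)]
        have hI : ∀ i, y i ∈ Set.Ioc 0 L := fun i =>
          ⟨lt_of_le_of_ne (h.2 i).1 (hy i).symm, (h.2 i).2⟩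
        have hmono : ∀ᶠ M : ℕ in atTop, StrictMono (fun i => nuSite L M (y i)) := by
          have : ∀ᶠ M : ℕ in atTop, ∀ i j, i < j → nuSite L M (y i) < nuSite L M (y j) := by
            rw [eventually_all]
            intro i
            rw [eventually_all]
            intro j
            by_cases hij : i < j
            · simpa [hij] using nu_lt L hL (y i) (y j) (hI i).1 (h.1 hij)
            · simp [hij]
          filter_upwards [this] with M hM i j hij using hM i j hij
        have hT : ∀ l : Fin N → ℝ, Tendsto (fun M : ℕ => ∑ σ : Equiv.Perm (Fin N),
            aFac c N l σ * ∏ a, sFac c L M (l (σ a)) (nuSite L M (y a))) atTop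
            (nhds (∑ σ : Equiv.Perm (Fin N),
              aFac c N l σ * ∏ a, eFac L (l (σ a)) (y a))) := fun l =>
          tendsto_finset_sum _ fun σ _ => (tendsto_finset_prod _ fun a _ =>
            sFac_tendsto c L (l (σ a)) (y a) hL (hI a)).const_mul _
        have hfin := ((Complex.continuous_conj.tendsto _).comp (hT mu)).mul (hT lam)
        have hpre : ((c : ℂ) ^ N)⁻¹ * ((starRingEnd ℂ) ((-Complex.I * (Real.sqrt c : ℂ)) ^ N) *
            (-Complex.I * (Real.sqrt c : ℂ)) ^ N) = 1 := by
          have hs : (Real.sqrt c : ℂ) * (Real.sqrt c : ℂ) = c := by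
            rw [← Complex.ofReal_mul, Real.mul_self_sqrt hc.le]
          have hc' : (c : ℂ) ≠ 0 := by exact_mod_cast hc.ne'
          rw [map_pow, ← mul_pow, map_mul, map_neg, Complex.conj_I, Complex.conj_ofReal]
          have : - -Complex.I * (Real.sqrt c : ℂ) * (-Complex.I * (Real.sqrt c : ℂ)) = c := by
            linear_combination hs - (Real.sqrt c : ℂ) * (Real.sqrt c : ℂ) * Complex.I_mul_I
          rw [this, inv_mul_cancel₀ (pow_ne_zero _ hc')]
        rw [betheWave_eq c L N mu y h.1, betheWave_eq c L N lam y h.1, map_mul]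
        refine (hfin.congr' ?_).trans (le_of_eq ?_)
        · filter_upwards [hmono] with M hM
          rw [if_pos ⟨hI, hM⟩, latticeF_eq c L M N mu _ hM, latticeF_eq c L M N lam _ hM]
          rfl
        · congr 1
          rw [mul_mul_mul_comm, ← mul_assoc, hpre, one_mul]
      · rw [Set.indicator_of_notMem (by exact h), mul_zero]
        refine tendsto_const_nhds.congr fun M => ?_
        rw [if_neg]
        rintro ⟨ha, hb⟩
        exact h ⟨fun i j hij => nu_lt_imp L hL M _ _ (hb hij),
          fun i => Set.Ioc_subset_Icc_self (ha i)⟩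
    refine hlim.congr' ?_
    filter_upwards [eventually_gt_atTop 0] with M hM
    rw [key M hM]
end
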